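/- arXiv:1902.02936 — 4 statements merged into one kernel-verified Lean document; each statement's English description precedes it below -/
import Mathlib

section
/- Let p be an odd prime. There is no spectral set of size p(p − 1) in 𝔽_p^3. -/
open Finset

/-- The character `x ↦ e^{2πi (x·a)/p}` on `𝔽_p^d`. -/
noncomputable def chr (p : ℕ) {d : ℕ} (a x : Fin d → ZMod p) : ℂ :=
  Complex.exp (2 * (Real.pi : ℂ) * Complex.I *
    ((ZMod.val (∑ i, x i * a i) : ℕ) : ℂ) / (p : ℂ))

/-- `(E, A)` is a spectral pair: the characters `χ_a`, `a ∈ A`, restricted to `E`,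
are pairwise orthogonal, span `L²(E)`, and are linearly independent, i.e. they
form an orthogonal basis of `L²(E)`. -/
def IsSpectralPair (p : ℕ) {d : ℕ} (E A : Finset (Fin d → ZMod p)) : Prop :=
  (∀ a ∈ A, ∀ b ∈ A, a ≠ b →
    ∑ x ∈ E, chr p a x * (starRingEnd ℂ) (chr p b x) = 0) ∧
  (∀ f : E → ℂ, ∃ c : A → ℂ, ∀ x : E, f x = ∑ a : A, c a * chr p a.1 x.1) ∧
  (∀ c : A → ℂ, (∀ x : E, ∑ a : A, c a * chr p a.1 x.1 = 0) → ∀ a, c a = 0)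

/-- `E` is a spectral set. -/
def IsSpectral (p : ℕ) {d : ℕ} (E : Finset (Fin d → ZMod p)) : Prop :=
  ∃ A, IsSpectralPair p E A

/-- `E` tiles `𝔽_p^d` by translation. -/
def Tiles (p : ℕ) {d : ℕ} (E : Finset (Fin d → ZMod p)) : Prop :=
  ∃ A : Finset (Fin d → ZMod p),
    ∀ x, (∑ a ∈ A, if x - a ∈ E then (1 : ℕ) else 0) = 1

/-- `E` determines the direction (one-dimensional subspace) `D`. -/
def Determines (p : ℕ) {d : ℕ} (E : Finset (Fin d → ZMod p))
    (D : Submodule (ZMod p) (Fin d → ZMod p)) : Prop :=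
  ∃ e₁ ∈ E, ∃ e₂ ∈ E, e₁ ≠ e₂ ∧ e₁ - e₂ ∈ D

/-- The Fourier transform of the indicator function of `E`. -/
noncomputable def ftE (p : ℕ) {d : ℕ} (E : Finset (Fin d → ZMod p))
    (ξ : Fin d → ZMod p) : ℂ :=
  ((p : ℂ) ^ d)⁻¹ * ∑ x ∈ E, Complex.exp (-(2 * (Real.pi : ℂ) * Complex.I *
    ((ZMod.val (∑ i, x i * ξ i) : ℕ) : ℂ) / (p : ℂ)))

/-- The orthogonal set `S^⊥ = {x : x · y = 0 for all y ∈ S}`. -/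
def perpSet (p : ℕ) {d : ℕ} (S : Submodule (ZMod p) (Fin d → ZMod p)) :
    Set (Fin d → ZMod p) :=
  {x | ∀ y ∈ S, ∑ i, x i * y i = 0}

namespace SpecAux

variable {p : ℕ} [Fact p.Prime]

/-- Vectors of `𝔽_p^3`. -/
abbrev V (p : ℕ) := Fin 3 → ZMod p

/-- The standard additive character of `ZMod p`. -/
noncomputable abbrev ψ (p : ℕ) [Fact p.Prime] : AddChar (ZMod p) ℂ := ZMod.stdAddChar

lemma chr_eq (a x : V p) : chr p a x = ψ p (x ⬝ᵥ a) := by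
  have h := ZMod.stdAddChar_coe (N := p) (((x ⬝ᵥ a).val : ℕ) : ℤ)
  rw [Int.cast_natCast, Int.cast_natCast, ZMod.natCast_zmod_val] at h
  rw [ψ, h]
  rfl

lemma conj_psi (j : ZMod p) : (starRingEnd ℂ) (ψ p j) = ψ p (-j) := by
  rw [AddChar.map_neg_eq_conj]

lemma psi_prim {t : ZMod p} (ht : t ≠ 0) : IsPrimitiveRoot (ψ p t) p := by
  have hp : p.Prime := Fact.out
  have h1 : (ψ p t) ^ p = 1 := by
    rw [← AddChar.map_nsmul_eq_pow]; simp
  have h2 : ψ p t ≠ 1 := by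
    intro h
    rw [← AddChar.map_zero_eq_one (ψ p)] at h
    exact ht (ZMod.injective_stdAddChar h)
  exact IsPrimitiveRoot.iff_orderOf.2 (orderOf_eq_prime h1 h2)

lemma psi_mul (t j : ZMod p) : ψ p (t * j) = (ψ p t) ^ j.val := by
  rw [← AddChar.map_nsmul_eq_pow]
  congr 1
  rw [nsmul_eq_mul, ZMod.natCast_val, ZMod.cast_id', id_eq, mul_comm]

/-- Galois invariance of vanishing character sums. -/
lemma galois {α : Type*} (S : Finset α) (g : α → ZMod p) (h : ∑ x ∈ S, ψ p (g x) = 0)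
    {t : ZMod p} (ht : t ≠ 0) : ∑ x ∈ S, ψ p (t * g x) = 0 := by
  have hp : p.Prime := Fact.out
  let P : Polynomial ℚ := ∑ x ∈ S, Polynomial.X ^ (g x).val
  have key : ∀ t : ZMod p, Polynomial.aeval (ψ p t) P = ∑ x ∈ S, ψ p (t * g x) := by
    intro t
    simp only [P, map_sum, map_pow, Polynomial.aeval_X]
    exact Finset.sum_congr rfl fun x _ => (psi_mul t (g x)).symm
  have h1 : Polynomial.aeval (ψ p 1) P = 0 := by rw [key]; simpa using h
  have hd := minpoly.dvd ℚ _ h1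
  rw [← Polynomial.cyclotomic_eq_minpoly_rat (psi_prim one_ne_zero) hp.pos,
    Polynomial.cyclotomic_eq_minpoly_rat (psi_prim ht) hp.pos] at hd
  rw [← key]
  obtain ⟨Q, hQ⟩ := hd
  rw [hQ, map_mul, minpoly.aeval, zero_mul]

lemma exists_dot_one {n : V p} (hn : n ≠ 0) : ∃ e : V p, e ⬝ᵥ n = 1 := by
  obtain ⟨i, hi⟩ := Function.ne_iff.1 hn
  refine ⟨Pi.single i (n i)⁻¹, ?_⟩
  rw [single_dotProduct]
  exact inv_mul_cancel₀ hi

lemma card_plane {n : V p} (hn : n ≠ 0) (c : ZMod p) :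
    #{x : V p | x ⬝ᵥ n = c} = p ^ 2 := by
  have hp : p.Prime := Fact.out
  obtain ⟨e, he⟩ := exists_dot_one hn
  have heq : ∀ c' : ZMod p, #{x : V p | x ⬝ᵥ n = c'} = #{x : V p | x ⬝ᵥ n = c} := by
    intro c'
    apply Finset.card_bij (fun x _ => x + (c - c') • e)
    · intro x hx
      simp only [mem_filter, mem_univ, true_and] at hx ⊢
      rw [add_dotProduct, smul_dotProduct, he, hx]; simp
    · intro x _ y _ h
      exact add_right_cancel h
    · intro y hy
      simp only [mem_filter, mem_univ, true_and] at hy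
      refine ⟨y - (c - c') • e, ?_, by simp⟩
      simp only [mem_filter, mem_univ, true_and]
      rw [sub_dotProduct, smul_dotProduct, he, hy]; simp
  have hs := Finset.card_eq_sum_card_fiberwise (s := (univ : Finset (V p)))
    (t := (univ : Finset (ZMod p))) (f := fun x => x ⬝ᵥ n) (by intro x _; simp)
  rw [Finset.sum_congr rfl fun c' _ => heq c'] at hs
  simp only [card_univ, Fintype.card_pi, ZMod.card, prod_const, Fintype.card_fin, sum_const,
    smul_eq_mul] at hs
  have : p * p ^ 2 = p * #{x : V p | x ⬝ᵥ n = c} := by rw [← hs]; ring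
  exact (Nat.eq_of_mul_eq_mul_left hp.pos this).symm

lemma card_two (u w : V p) : p ≤ #{n : V p | n ⬝ᵥ u = 0 ∧ n ⬝ᵥ w = 0} := by
  have hp : p.Prime := Fact.out
  obtain ⟨y, _, hy⟩ := Finset.exists_le_card_fiber_of_mul_le_card_of_maps_to
    (s := (univ : Finset (V p))) (t := (univ : Finset (ZMod p × ZMod p)))
    (f := fun n => (n ⬝ᵥ u, n ⬝ᵥ w)) (n := p) (by intro x _; simp) ⟨0, by simp⟩ (by
      simp only [card_univ, Fintype.card_prod, Fintype.card_pi, ZMod.card, prod_const,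
        Fintype.card_fin]
      apply le_of_eq; ring)
  refine hy.trans ?_
  have hne : (Finset.filter (fun n : V p => (n ⬝ᵥ u, n ⬝ᵥ w) = y) univ).Nonempty :=
    Finset.card_pos.1 (lt_of_lt_of_le hp.pos hy)
  obtain ⟨n0, hn0⟩ := hne
  simp only [mem_filter, mem_univ, true_and] at hn0
  apply Finset.card_le_card_of_injOn (fun n => n - n0)
  · intro n hn
    simp only [coe_filter, mem_univ, true_and, Set.mem_ofPred_eq] at hn ⊢
    rw [← hn0, Prod.mk.injEq] at hn
    rw [sub_dotProduct, sub_dotProduct, hn.1, hn.2]; simp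
  · intro a _ b _ h
    exact sub_left_injective h

/-- Character sums over a plane through the origin. -/
lemma sum_plane {n : V p} (hn : n ≠ 0) (x : V p) :
    ∃ k : ℕ, ∑ w : V p with w ⬝ᵥ n = 0, ψ p (x ⬝ᵥ w) = ((p ^ 2 * k : ℕ) : ℂ) := by
  by_cases h : ∀ w : V p, w ⬝ᵥ n = 0 → ψ p (x ⬝ᵥ w) = 1
  · refine ⟨1, ?_⟩
    rw [Finset.sum_congr rfl (g := fun _ => (1 : ℂ))]
    · rw [sum_const, card_plane hn]; simp
    · intro w hw
      exact h w (by simpa using hw)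
  · push Not at h
    obtain ⟨w0, hw0, hne⟩ := h
    refine ⟨0, ?_⟩
    have : ψ p (x ⬝ᵥ w0) * ∑ w : V p with w ⬝ᵥ n = 0, ψ p (x ⬝ᵥ w)
        = ∑ w : V p with w ⬝ᵥ n = 0, ψ p (x ⬝ᵥ w) := by
      rw [Finset.mul_sum]
      apply Finset.sum_bij (fun w _ => w0 + w)
      · intro w hw
        simp only [mem_filter, mem_univ, true_and] at hw ⊢
        rw [add_dotProduct, hw0, hw, add_zero]
      · intro a _ b _ h
        exact add_left_cancel h
      · intro b hb
        simp only [mem_filter, mem_univ, true_and] at hb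
        refine ⟨b - w0, ?_, by simp⟩
        simp only [mem_filter, mem_univ, true_and]
        rw [sub_dotProduct, hw0, hb, sub_zero]
      · intro w _
        rw [dotProduct_add, AddChar.map_add_eq_mul]
    have h2 : (ψ p (x ⬝ᵥ w0) - 1) * ∑ w : V p with w ⬝ᵥ n = 0, ψ p (x ⬝ᵥ w) = 0 := by
      rw [sub_mul, this, one_mul, sub_self]
    rcases mul_eq_zero.1 h2 with h3 | h3
    · exact absurd (sub_eq_zero.1 h3) hne
    · rw [h3]; simp

/-- Some nonzero vector of the plane `n^⊥` has nonvanishing Fourier coefficient. -/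
lemma exists_nonzero (E : Finset (V p)) (hE : E.card = p * (p - 1)) {n : V p} (hn : n ≠ 0) :
    ∃ w : V p, w ≠ 0 ∧ w ⬝ᵥ n = 0 ∧ ∑ x ∈ E, ψ p (x ⬝ᵥ w) ≠ 0 := by
  have hp : p.Prime := Fact.out
  by_contra! hcon
  have h1 : ∑ w : V p with w ⬝ᵥ n = 0, ∑ x ∈ E, ψ p (x ⬝ᵥ w) = (E.card : ℂ) := by
    rw [Finset.sum_eq_single 0]
    · simp
    · intro w hw hw0
      exact hcon w hw0 (by simpa using hw)
    · intro h; simp at h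
  rw [Finset.sum_comm] at h1
  choose k hk using sum_plane hn
  rw [Finset.sum_congr rfl fun x _ => hk x, ← Nat.cast_sum, ← Finset.mul_sum] at h1
  have h2 : p ^ 2 * ∑ x ∈ E, k x = p * (p - 1) := by rw [← hE]; exact_mod_cast h1
  have h3 : p ∣ p - 1 := by
    refine ⟨∑ x ∈ E, k x, ?_⟩
    apply Nat.eq_of_mul_eq_mul_left hp.pos
    rw [← h2]; ring
  have := Nat.le_of_dvd (by have := hp.two_le; omega) h3
  have := hp.two_le
  omega

/-- Every plane contains at most `p` points of a spectrum. -/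
lemma plane_le (E A : Finset (V p)) (hE : E.card = p * (p - 1))
    (hA : ∀ a ∈ A, ∀ b ∈ A, a ≠ b → ∑ x ∈ E, ψ p (x ⬝ᵥ (a - b)) = 0)
    {n : V p} (hn : n ≠ 0) (c : ZMod p) : #{a ∈ A | a ⬝ᵥ n = c} ≤ p := by
  have hp : p.Prime := Fact.out
  obtain ⟨w, hw0, hwn, hw⟩ := exists_nonzero E hE hn
  have hle : #({a ∈ A | a ⬝ᵥ n = c} ×ˢ (univ : Finset (ZMod p))) ≤ #{x : V p | x ⬝ᵥ n = c} := by
    apply Finset.card_le_card_of_injOn (fun q => q.1 + q.2 • w)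
    · rintro ⟨a, t⟩ h
      simp only [coe_product, Set.mem_prod, mem_coe, mem_filter, mem_univ, and_true,
        true_and] at h ⊢
      simp [add_dotProduct, smul_dotProduct, hwn, h.2]
    · rintro ⟨a, t⟩ h ⟨b, s⟩ h' heq
      simp only [coe_product, Set.mem_prod, mem_coe, mem_filter, mem_univ, and_true] at h h'
      simp only at heq
      have hd : a - b = (s - t) • w := by
        rw [sub_smul, sub_eq_sub_iff_add_eq_add, heq, add_comm]
      by_cases hab : a = b
      · subst hab
        rw [sub_self] at hd
        rcases smul_eq_zero.1 hd.symm with h0 | h0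
        · rw [sub_eq_zero.1 h0]
        · exact absurd h0 hw0
      · exfalso
        have hst : s - t ≠ 0 := by
          intro h0
          rw [h0, zero_smul] at hd
          exact hab (sub_eq_zero.1 hd)
        have h1 := hA a h.1 b h'.1 hab
        have h2 := galois E (fun x => x ⬝ᵥ (a - b)) h1 (inv_ne_zero hst)
        apply hw
        rw [← h2]
        refine Finset.sum_congr rfl fun x _ => ?_
        rw [hd, dotProduct_smul, smul_eq_mul, inv_mul_cancel_left₀ hst]
  rw [card_plane hn, card_product, card_univ, ZMod.card, pow_two] at hle
  exact Nat.le_of_mul_le_mul_right hle hp.pos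

/-- Equidistribution. -/
lemma equi (A : Finset (V p)) (hA : A.card = p * (p - 1)) (u : V p)
    (h : ∑ a ∈ A, ψ p (a ⬝ᵥ u) = 0) (c : ZMod p) : #{a ∈ A | a ⬝ᵥ u = c} = p - 1 := by
  have hp : p.Prime := Fact.out
  have h1 : ∑ t : ZMod p, ∑ a ∈ A, ψ p (t * (a ⬝ᵥ u - c)) = (A.card : ℂ) := by
    rw [Finset.sum_eq_single 0]
    · simp
    · intro t _ ht
      have h2 := galois A (fun x => x ⬝ᵥ u) h ht
      have : ∀ a ∈ A, ψ p (t * (a ⬝ᵥ u - c)) = ψ p (t * (a ⬝ᵥ u)) * ψ p (-(t * c)) := by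
        intro a _
        rw [← AddChar.map_add_eq_mul]; congr 1; ring
      rw [Finset.sum_congr rfl this, ← Finset.sum_mul, h2, zero_mul]
    · intro h; simp at h
  rw [Finset.sum_comm] at h1
  have h3 : ∀ a ∈ A, ∑ t : ZMod p, ψ p (t * (a ⬝ᵥ u - c)) = if a ⬝ᵥ u = c then (p : ℂ) else 0 := by
    intro a _
    rw [AddChar.sum_mulShift _ (ZMod.isPrimitive_stdAddChar p)]
    simp [sub_eq_zero, ZMod.card]
  rw [Finset.sum_congr rfl h3, ← Finset.sum_filter, sum_const, hA, nsmul_eq_mul] at h1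
  have h4 : #{a ∈ A | a ⬝ᵥ u = c} * p = p * (p - 1) := by exact_mod_cast h1
  rw [mul_comm] at h4
  exact Nat.eq_of_mul_eq_mul_left hp.pos h4

/-- The combinatorial core. -/
lemma core (hp3 : 3 ≤ p) (A : Finset (V p)) (hA : A.card = p * (p - 1))
    (hle : ∀ n : V p, n ≠ 0 → ∀ c, #{a ∈ A | a ⬝ᵥ n = c} ≤ p)
    {n0 : V p} (hn0 : n0 ≠ 0) (heq : #{a ∈ A | a ⬝ᵥ n0 = 0} = p - 1) : False := by
  obtain ⟨a, ha, b, hb, hab⟩ := Finset.one_lt_card.1 (show 1 < #{a ∈ A | a ⬝ᵥ n0 = 0} by omega)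
  simp only [mem_filter] at ha hb
  set u := b - a with hu
  have hu0 : u ≠ 0 := fun h => hab (sub_eq_zero.1 h).symm
  let N : Finset (V p) := {n : V p | n ⬝ᵥ u = 0}
  have hN : #N = p ^ 2 := card_plane hu0 0
  have h0N : (0 : V p) ∈ N := by simp [N]
  have hN' : #(N.erase 0) = p ^ 2 - 1 := by rw [card_erase_of_mem h0N, hN]
  have hn0N : n0 ∈ N.erase 0 := by
    simp only [N, mem_erase, mem_filter, mem_univ, true_and]
    refine ⟨hn0, ?_⟩
    rw [dotProduct_comm, hu, sub_dotProduct, ha.2, hb.2, sub_zero]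
  -- upper bound
  have hup : ∑ n ∈ N.erase 0, #{x ∈ A | x ⬝ᵥ n = a ⬝ᵥ n} < (p ^ 2 - 1) * p := by
    rw [← hN', ← smul_eq_mul, ← Finset.sum_const]
    apply Finset.sum_lt_sum
    · intro n hn
      exact hle n (Finset.ne_of_mem_erase hn) _
    · refine ⟨n0, hn0N, ?_⟩
      rw [ha.2, heq]; omega
  -- double counting
  have hdc : ∑ n ∈ N.erase 0, #{x ∈ A | x ⬝ᵥ n = a ⬝ᵥ n}
      = ∑ x ∈ A, #{n ∈ N.erase 0 | x ⬝ᵥ n = a ⬝ᵥ n} := by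
    exact Finset.sum_card_bipartiteAbove_eq_sum_card_bipartiteBelow
      (fun (n x : V p) => x ⬝ᵥ n = a ⬝ᵥ n)
  have hlow : ∀ x ∈ A, p - 1 ≤ #{n ∈ N.erase 0 | x ⬝ᵥ n = a ⬝ᵥ n} := by
    intro x _
    have h := card_two u (x - a)
    have : ({n ∈ N.erase 0 | x ⬝ᵥ n = a ⬝ᵥ n})
        = ({n : V p | n ⬝ᵥ u = 0 ∧ n ⬝ᵥ (x - a) = 0} : Finset (V p)).erase 0 := by
      ext n
      simp only [N, mem_filter, mem_erase, mem_univ, true_and, dotProduct_sub, sub_eq_zero,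
        dotProduct_comm n x, dotProduct_comm n a]
      tauto
    rw [this, card_erase_of_mem (by simp)]
    omega
  have hA' : #((A.erase a).erase b) = p * (p - 1) - 2 := by
    rw [card_erase_of_mem (mem_erase.2 ⟨hab.symm, hb.1⟩), card_erase_of_mem ha.1, hA]; omega
  have hfa : #{n ∈ N.erase 0 | a ⬝ᵥ n = a ⬝ᵥ n} = p ^ 2 - 1 := by simp [hN']
  have hfb : #{n ∈ N.erase 0 | b ⬝ᵥ n = a ⬝ᵥ n} = p ^ 2 - 1 := by
    rw [Finset.filter_true_of_mem, hN']
    intro n hn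
    have := Finset.mem_of_mem_erase hn
    simp only [N, mem_filter, mem_univ, true_and] at this
    rw [dotProduct_comm, hu, sub_dotProduct] at this
    exact sub_eq_zero.1 this
  have hsum : (p ^ 2 - 1) + ((p ^ 2 - 1) + (p * (p - 1) - 2) * (p - 1))
      ≤ ∑ x ∈ A, #{n ∈ N.erase 0 | x ⬝ᵥ n = a ⬝ᵥ n} := by
    rw [← Finset.add_sum_erase _ _ ha.1,
      ← Finset.add_sum_erase _ _ (mem_erase.2 ⟨hab.symm, hb.1⟩), hfa, hfb, ← hA']
    gcongr
    rw [← smul_eq_mul, ← Finset.sum_const]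
    exact Finset.sum_le_sum fun x hx => hlow x (mem_of_mem_erase (mem_of_mem_erase hx))
  rw [← hdc] at hsum
  have hlt := lt_of_le_of_lt hsum hup
  obtain ⟨q, rfl⟩ : ∃ q, p = q + 3 := ⟨p - 3, by omega⟩
  have e1 : (q + 3) ^ 2 - 1 = q ^ 2 + 6 * q + 8 := by
    rw [show (q + 3) ^ 2 = q ^ 2 + 6 * q + 8 + 1 by ring]; rfl
  have e2 : q + 3 - 1 = q + 2 := rfl
  have e3 : (q + 3) * (q + 2) - 2 = q ^ 2 + 5 * q + 4 := by
    rw [show (q + 3) * (q + 2) = q ^ 2 + 5 * q + 4 + 2 by ring]; rfl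
  rw [e1, e2, e3] at hlt
  nlinarith

end SpecAux

open SpecAux in
/-- For an odd prime `p`, there is no spectral set of size `p(p - 1)` in `𝔽_p^3`. -/
theorem no_spectral_of_card_p_mul_p_sub_one (p : ℕ) (hp : p.Prime) (hodd : Odd p)
    (E : Finset (Fin 3 → ZMod p)) (hE : E.card = p * (p - 1)) :
    ¬ IsSpectral p E := by
  rintro ⟨A, horth, hspan, hind⟩
  haveI : Fact p.Prime := ⟨hp⟩
  have hp3 : 3 ≤ p := by
    have := hp.two_le
    rcases hodd with ⟨k, hk⟩
    omega
  -- the character matrix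
  let M : Matrix E A ℂ := Matrix.of fun x a => chr p a.1 x.1
  have hMv : ∀ (c : A → ℂ) (x : E), M.mulVecLin c x = ∑ a : A, c a * chr p a.1 x.1 := by
    intro c x
    simp [M, Matrix.mulVec, dotProduct, mul_comm]
  have hbij : Function.Bijective M.mulVecLin := by
    constructor
    · rw [← LinearMap.ker_eq_bot, LinearMap.ker_eq_bot']
      intro c hc
      funext a
      exact hind c (fun x => by rw [← hMv, hc]; rfl) a
    · intro f
      obtain ⟨c, hc⟩ := hspan f
      exact ⟨c, funext fun x => by rw [hMv, hc]⟩
  have hcard : Fintype.card A = Fintype.card E := by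
    have := (LinearEquiv.ofBijective _ hbij).finrank_eq
    simpa using this
  have hAE : A.card = E.card := by simpa using hcard
  have hEpos : (E.card : ℂ) ≠ 0 := by
    rw [hE, Nat.cast_ne_zero]
    exact (Nat.mul_pos hp.pos (by omega)).ne'
  have hA : ∀ a ∈ A, ∀ b ∈ A, a ≠ b → ∑ x ∈ E, ψ p (x ⬝ᵥ (a - b)) = 0 := by
    intro a ha b hb hab
    rw [← horth a ha b hb hab]
    refine Finset.sum_congr rfl fun x _ => ?_
    rw [chr_eq, chr_eq, conj_psi, ← AddChar.map_add_eq_mul, dotProduct_sub, sub_eq_add_neg]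
  have hMM : ((E.card : ℂ)⁻¹ • M.conjTranspose) * M = 1 := by
    ext a b
    rw [Matrix.smul_mul, Matrix.smul_apply, Matrix.mul_apply]
    have : ∑ x : E, M.conjTranspose a x * M x b
        = ∑ x ∈ E, ψ p (x ⬝ᵥ (b.1 - a.1)) := by
      rw [← Finset.sum_coe_sort E]
      refine Finset.sum_congr rfl fun x _ => ?_
      rw [Matrix.conjTranspose_apply]
      simp only [M, Matrix.of_apply]
      rw [chr_eq, chr_eq, ← starRingEnd_apply, conj_psi, ← AddChar.map_add_eq_mul,
        dotProduct_sub, sub_eq_add_neg, add_comm]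
    rw [this]
    by_cases hab : a = b
    · subst hab
      simp [hEpos]
    · rw [hA b.1 b.2 a.1 a.2 (fun h => hab (Subtype.ext h.symm)), Matrix.one_apply_ne hab]
      simp
  have hMM' := (Matrix.mul_eq_one_comm_of_equiv (Fintype.equivOfCardEq hcard)).1 hMM
  obtain ⟨x, hx, y, hy, hxy⟩ := Finset.one_lt_card.1 (show 1 < E.card by
    rw [hE]
    have : 2 ≤ p - 1 := by omega
    nlinarith)
  have hdual : ∑ a ∈ A, ψ p (a ⬝ᵥ (x - y)) = 0 := by
    have h := congrFun (congrFun hMM' ⟨x, hx⟩) ⟨y, hy⟩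
    rw [Matrix.one_apply_ne (by simpa using hxy), Matrix.mul_smul, Matrix.smul_apply,
      Matrix.mul_apply, smul_eq_mul] at h
    have h' := (mul_eq_zero.1 h).resolve_left (inv_ne_zero hEpos)
    rw [← h', ← Finset.sum_coe_sort A]
    refine Finset.sum_congr rfl fun a _ => ?_
    rw [Matrix.conjTranspose_apply]
    simp only [M, Matrix.of_apply]
    rw [chr_eq, chr_eq, ← starRingEnd_apply, conj_psi, ← AddChar.map_add_eq_mul,
      dotProduct_sub, sub_eq_add_neg, dotProduct_comm x, dotProduct_comm y]
  have hAc : A.card = p * (p - 1) := hAE.trans hE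
  exact core hp3 A hAc (fun n hn c => plane_le E A hE hA hn c) (sub_ne_zero.2 hxy)
    (equi A hAc (x - y) hdual 0)
end

section
/- Let p ≥ 5 be a prime. No subset of 𝔽_p^3 of size p(p − 2) is spectral. -/
open Finset

namespace Spec

open Polynomial in
lemma const_of_sum_zero (p : ℕ) [hp : Fact p.Prime] (c : ZMod p → ℚ)
    (h : ∑ t : ZMod p, (c t : ℂ) * ZMod.stdAddChar t = 0) : ∀ s t, c s = c t := by
  set ζ : ℂ := ZMod.stdAddChar (1 : ZMod p) with hζ
  have hprim : IsPrimitiveRoot ζ p := by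
    rw [hζ, ZMod.stdAddChar_apply, ZMod.toCircle_apply, ZMod.val_one p]
    have := Complex.isPrimitiveRoot_exp p hp.out.ne_zero
    simpa using this
  have hpow : ∀ t : ZMod p, ZMod.stdAddChar t = ζ ^ t.val := by
    intro t
    rw [hζ, ← AddChar.map_nsmul_eq_pow]
    congr 1
    simp
  set f : ℚ[X] := ∑ t : ZMod p, Polynomial.C (c t) * X ^ t.val with hf
  have hfz : aeval ζ f = 0 := by
    rw [hf, map_sum, ← h]
    refine Finset.sum_congr rfl fun t _ => ?_
    rw [hpow]
    simp
  have hdvd : cyclotomic p ℚ ∣ f := by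
    rw [cyclotomic_eq_minpoly_rat hprim hp.out.pos]
    exact minpoly.dvd _ _ hfz
  have hcoef : ∀ t : ZMod p, f.coeff t.val = c t := by
    intro t
    rw [hf, finsetSum_coeff]
    simp only [coeff_C_mul, coeff_X_pow]
    rw [Finset.sum_eq_single t]
    · simp
    · intro b _ hb
      rw [if_neg]
      · simp
      · intro h; exact hb (ZMod.val_injective p h.symm)
    · simp
  have hdeg : f.natDegree ≤ p - 1 := by
    rw [hf]
    refine natDegree_sum_le_of_forall_le _ _ fun t _ => ?_
    refine (natDegree_C_mul_X_pow_le _ _).trans ?_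
    have := ZMod.val_lt t
    omega
  obtain ⟨g, hg⟩ := hdvd
  have hk : ∃ k : ℚ, g = Polynomial.C k := by
    by_cases hg0 : g = 0
    · exact ⟨0, by simp [hg0]⟩
    refine ⟨g.coeff 0, eq_C_of_natDegree_eq_zero ?_⟩
    have h1 := natDegree_mul (cyclotomic_ne_zero p ℚ) hg0
    rw [← hg, natDegree_cyclotomic, Nat.totient_prime hp.out] at h1
    omega
  obtain ⟨k, rfl⟩ := hk
  have : ∀ t, c t = k := by
    intro t
    rw [← hcoef, hg, coeff_mul_C, cyclotomic_prime, finsetSum_coeff]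
    simp only [coeff_X_pow]
    rw [Finset.sum_ite_eq]
    simp [ZMod.val_lt t]
  intro s t
  rw [this, this]

/-- number of points on a plane -/
def pl {p : ℕ} (E : Finset (Fin 3 → ZMod p)) (ξ : Fin 3 → ZMod p) (t : ZMod p) : ℕ :=
  (E.filter (fun x => x ⬝ᵥ ξ = t)).card

lemma pl_const_of_sum {p : ℕ} [hp : Fact p.Prime] (E : Finset (Fin 3 → ZMod p))
    (ξ : Fin 3 → ZMod p) (h : ∑ x ∈ E, (ZMod.stdAddChar (x ⬝ᵥ ξ) : ℂ) = 0) :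
    ∀ s t, pl E ξ s = pl E ξ t := by
  have := const_of_sum_zero p (fun t => (pl E ξ t : ℚ)) ?_
  · intro s t
    exact_mod_cast this s t
  rw [← h, ← Finset.sum_fiberwise_of_maps_to (s := E) (t := univ) (g := fun x => x ⬝ᵥ ξ)
    (fun _ _ => mem_univ _)]
  refine Finset.sum_congr rfl fun t _ => ?_
  rw [Finset.sum_congr rfl (g := fun _ => (ZMod.stdAddChar t : ℂ))]
  · simp [pl]
  · intro x hx
    rw [(mem_filter.1 hx).2]

lemma chr_eq {p : ℕ} [hp : Fact p.Prime] (a x : Fin 3 → ZMod p) :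
    chr p a x = ZMod.stdAddChar (x ⬝ᵥ a) := by
  rw [ZMod.stdAddChar_apply, ZMod.toCircle_apply]
  rfl

lemma chr_mul {p : ℕ} [hp : Fact p.Prime] (a b x : Fin 3 → ZMod p) :
    chr p a x * (starRingEnd ℂ) (chr p b x) = ZMod.stdAddChar (x ⬝ᵥ (a - b)) := by
  rw [chr_eq, chr_eq, ← AddChar.map_neg_eq_conj, ← AddChar.map_add_eq_mul, dotProduct_sub,
    sub_eq_add_neg]

lemma chr_mul' {p : ℕ} [hp : Fact p.Prime] (a x y : Fin 3 → ZMod p) :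
    (starRingEnd ℂ) (chr p a x) * (chr p a y) = ZMod.stdAddChar (a ⬝ᵥ (y - x)) := by
  rw [chr_eq, chr_eq, ← AddChar.map_neg_eq_conj, ← AddChar.map_add_eq_mul, dotProduct_comm a,
    sub_dotProduct]
  congr 1
  ring

lemma card_eq {p : ℕ} [hp : Fact p.Prime] {E A : Finset (Fin 3 → ZMod p)}
    (h : IsSpectralPair p E A) : A.card = E.card := by
  obtain ⟨-, h2, h3⟩ := h
  let v : A → (E → ℂ) := fun a x => chr p a.1 x.1
  have hli : LinearIndependent ℂ v := by
    rw [Fintype.linearIndependent_iff]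
    intro c hc
    refine h3 c fun x => ?_
    have := congrFun hc x
    simpa [v] using this
  have hsp : ⊤ ≤ Submodule.span ℂ (Set.range v) := by
    intro f _
    obtain ⟨c, hc⟩ := h2 f
    have : f = ∑ a, c a • v a := by
      ext x
      simp [v, hc x]
    rw [this]
    exact Submodule.sum_mem _ fun a _ => Submodule.smul_mem _ _ (Submodule.subset_span ⟨a, rfl⟩)
  have := Module.finrank_eq_card_basis (Module.Basis.mk hli hsp)
  simpa using this.symm

lemma dual_orth {p : ℕ} [hp : Fact p.Prime] {E A : Finset (Fin 3 → ZMod p)}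
    (h : IsSpectralPair p E A) : ∀ x ∈ E, ∀ y ∈ E, x ≠ y →
      ∑ a ∈ A, (ZMod.stdAddChar (a ⬝ᵥ (y - x)) : ℂ) = 0 := by
  have hc := card_eq h
  intro x hx y hy hxy
  have hN : (E.card : ℂ) ≠ 0 := by
    exact_mod_cast (Finset.card_pos.2 ⟨x, hx⟩).ne'
  let H : Matrix A E ℂ := fun a x => chr p a.1 x.1
  have h1 : H * ((E.card : ℂ)⁻¹ • H.conjTranspose) = 1 := by
    ext a b
    rw [Matrix.mul_smul, Matrix.smul_apply, Matrix.mul_apply]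
    simp only [Matrix.conjTranspose_apply]
    change _ • ∑ j : E, chr p a.1 j.1 * (starRingEnd ℂ) (chr p b.1 j.1) = _
    rw [Finset.sum_coe_sort E (fun j => chr p a.1 j * (starRingEnd ℂ) (chr p b.1 j))]
    by_cases hab : a = b
    · subst hab
      simp only [chr_mul]
      simp [hN]
    · rw [h.1 a a.2 b b.2 (fun h => hab (Subtype.ext h)), Matrix.one_apply_ne hab]
      simp
  replace h1 := (Matrix.mul_eq_one_comm_of_card_eq (m := A) (n := E) (R := ℂ)
    (eq := show Fintype.card A = Fintype.card E by simpa using hc)).1 h1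
  have h2 := congrFun (congrFun h1 ⟨x, hx⟩) ⟨y, hy⟩
  rw [Matrix.smul_mul, Matrix.smul_apply, Matrix.mul_apply,
    Matrix.one_apply_ne (fun h => hxy (congrArg Subtype.val h))] at h2
  have h3 := (smul_eq_zero.1 h2).resolve_left (inv_ne_zero hN)
  simp only [Matrix.conjTranspose_apply] at h3
  change ∑ j : A, (starRingEnd ℂ) (chr p j.1 x) * chr p j.1 y = 0 at h3
  rw [Finset.sum_coe_sort A (fun j => (starRingEnd ℂ) (chr p j x) * chr p j y)] at h3
  simpa only [chr_mul'] using h3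

/-- equidistribution in the direction `v` -/
def Eqd {p : ℕ} (E : Finset (Fin 3 → ZMod p)) (v : Fin 3 → ZMod p) : Prop :=
  ∀ s t, pl E v s = pl E v t

lemma Eqd.smul {p : ℕ} [hp : Fact p.Prime] {E : Finset (Fin 3 → ZMod p)} {v : Fin 3 → ZMod p}
    (h : Eqd E v) {c : ZMod p} (hc : c ≠ 0) : Eqd E (c • v) := by
  have : ∀ t, pl E (c • v) t = pl E v (c⁻¹ * t) := by
    intro t
    unfold pl
    congr 1
    refine Finset.filter_congr fun x _ => ?_
    rw [dotProduct_smul, smul_eq_mul, eq_inv_mul_iff_mul_eq₀ hc]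
  intro s t
  rw [this, this]
  exact h _ _

lemma spectral_eqd {p : ℕ} [hp : Fact p.Prime] {E A : Finset (Fin 3 → ZMod p)}
    (h : IsSpectralPair p E A) :
    (∀ x ∈ E, ∀ y ∈ E, x ≠ y → Eqd A (x - y)) ∧ (∀ x ∈ A, ∀ y ∈ A, x ≠ y → Eqd E (x - y)) := by
  constructor
  · intro x hx y hy hxy
    exact pl_const_of_sum _ _ (dual_orth h y hy x hx hxy.symm)
  · intro x hx y hy hxy
    refine pl_const_of_sum _ _ ?_
    rw [← h.1 x hx y hy hxy]
    simp only [chr_mul]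

section counting
variable {p : ℕ} [hp : Fact p.Prime]

/-- `z` is a multiple of `v` -/
def Par (v z : Fin 3 → ZMod p) : Prop := z ∈ Submodule.span (ZMod p) {v}

noncomputable instance parDec (v : Fin 3 → ZMod p) : DecidablePred (Par v) :=
  Classical.decPred _

lemma card_perp (W : Submodule (ZMod p) (Fin 3 → ZMod p))
    [DecidablePred (fun ξ : Fin 3 → ZMod p => ∀ w ∈ W, w ⬝ᵥ ξ = 0)] :
    (Finset.univ.filter (fun ξ : Fin 3 → ZMod p => ∀ w ∈ W, w ⬝ᵥ ξ = 0)).card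
      = p ^ (3 - Module.finrank (ZMod p) W) := by
  classical
  let B : LinearMap.BilinForm (ZMod p) (Fin 3 → ZMod p) := dotProductBilin (ZMod p) (ZMod p)
  have hB : B.Nondegenerate := by
    refine ⟨fun x hx => ?_, fun x hx => ?_⟩
    · exact dotProduct_eq_zero x hx
    · refine dotProduct_eq_zero x fun w => ?_
      rw [dotProduct_comm]
      exact hx w
  have h1 := LinearMap.BilinForm.finrank_orthogonal hB W
  rw [Module.finrank_fin_fun] at h1
  rw [← h1]
  have h2 := Module.card_eq_pow_finrank (K := ZMod p) (V := B.orthogonal W)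
  rw [ZMod.card] at h2
  rw [← h2, Fintype.card_subtype]
  congr 1
  ext ξ
  simp only [mem_filter, mem_univ, true_and]
  rfl

lemma card_perp1 {z : Fin 3 → ZMod p} (hz : z ≠ 0) :
    (Finset.univ.filter (fun ξ : Fin 3 → ZMod p => z ⬝ᵥ ξ = 0)).card = p ^ 2 := by
  classical
  have := card_perp (Submodule.span (ZMod p) {z})
  rw [finrank_span_singleton hz] at this
  rw [← this]
  congr 1
  refine Finset.filter_congr fun ξ _ => ?_
  constructor
  · intro h w hw
    obtain ⟨c, rfl⟩ := Submodule.mem_span_singleton.1 hw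
    rw [smul_dotProduct, h, smul_zero]
  · intro h
    exact h z (Submodule.mem_span_singleton_self z)

lemma card_perp2 {v z : Fin 3 → ZMod p} (hv : v ≠ 0) :
    (Finset.univ.filter (fun ξ : Fin 3 → ZMod p => v ⬝ᵥ ξ = 0 ∧ z ⬝ᵥ ξ = 0)).card
     = if Par v z then p ^ 2 else p := by
  classical
  split_ifs with h
  · obtain ⟨c, rfl⟩ := Submodule.mem_span_singleton.1 h
    rw [← card_perp1 hv]
    congr 1
    refine Finset.filter_congr fun ξ _ => ?_
    constructor
    · exact fun h => h.1
    · intro h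
      exact ⟨h, by rw [smul_dotProduct, h, smul_zero]⟩
  · have hli : LinearIndependent (ZMod p) ![v, z] := by
      rw [LinearIndependent.pair_iff' hv]
      intro a ha
      exact h (Submodule.mem_span_singleton.2 ⟨a, ha⟩)
    have := card_perp (Submodule.span (ZMod p) (Set.range ![v, z]))
    rw [finrank_span_eq_card hli] at this
    simp only [Fintype.card_fin] at this
    have hr : Set.range ![v, z] = {v, z} := by
      ext w
      simp [eq_comm, or_comm]
    rw [show 3 - 2 = 1 from rfl, pow_one, hr] at this
    refine Eq.trans ?_ this
    congr 1
    refine Finset.filter_congr fun ξ _ => ?_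
    constructor
    · rintro ⟨h1, h2⟩ w hw
      obtain ⟨a, b, rfl⟩ := Submodule.mem_span_pair.1 hw
      simp [add_dotProduct, h1, h2]
    · intro h
      exact ⟨h v (Submodule.subset_span (Or.inl rfl)), h z (Submodule.subset_span (Or.inr rfl))⟩

lemma card_par {v : Fin 3 → ZMod p} (hv : v ≠ 0) :
    (Finset.univ.filter (fun z : Fin 3 → ZMod p => Par v z)).card = p := by
  classical
  have h2 := Module.card_eq_pow_finrank (K := ZMod p) (V := Submodule.span (ZMod p) {v})
  rw [ZMod.card, finrank_span_singleton hv, pow_one] at h2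
  refine Eq.trans ?_ h2
  rw [← Fintype.card_subtype]
  exact Fintype.card_congr (Equiv.refl _)

lemma par_symm {v w : Fin 3 → ZMod p} (hv : v ≠ 0) (h : Par w v) :
    Par v w := by
  obtain ⟨c, rfl⟩ := Submodule.mem_span_singleton.1 h
  have hc : c ≠ 0 := by
    rintro rfl
    simp at hv
  exact Submodule.mem_span_singleton.2 ⟨c⁻¹, by rw [smul_smul, inv_mul_cancel₀ hc, one_smul]⟩

end counting

section sums
variable {p : ℕ} [hp : Fact p.Prime]

/-- number of pairs of points in common planes -/
def Q (E : Finset (Fin 3 → ZMod p)) (ξ : Fin 3 → ZMod p) : ℤ :=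
  ∑ x ∈ E, ∑ y ∈ E, if (x - y) ⬝ᵥ ξ = 0 then 1 else 0

/-- number of points on the line through `x` with direction `v` -/
noncomputable def nL (E : Finset (Fin 3 → ZMod p)) (v x : Fin 3 → ZMod p) : ℤ :=
  ∑ y ∈ E, if Par v (x - y) then 1 else 0

/-- number of pairs of points in common lines -/
noncomputable def R (E : Finset (Fin 3 → ZMod p)) (v : Fin 3 → ZMod p) : ℤ :=
  ∑ x ∈ E, nL E v x

/-- energy -/
def S (E : Finset (Fin 3 → ZMod p)) (ξ : Fin 3 → ZMod p) : ℤ :=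
  if ξ = 0 then 0 else Q E ξ - p * (p - 2) ^ 2

/-- pairs of distinct points -/
noncomputable def tau (E : Finset (Fin 3 → ZMod p)) (v : Fin 3 → ZMod p) : ℤ :=
  if v = 0 then 0 else R E v - E.card

/-- energy on a line -/
def B (E : Finset (Fin 3 → ZMod p)) (v : Fin 3 → ZMod p) : ℤ :=
  ∑ ξ ∈ univ.filter (fun ξ => v ⬝ᵥ ξ = 0), S E ξ

lemma pl_eq (E : Finset (Fin 3 → ZMod p)) (ξ x : Fin 3 → ZMod p) :
    (pl E ξ (x ⬝ᵥ ξ) : ℤ) = ∑ y ∈ E, if (x - y) ⬝ᵥ ξ = 0 then 1 else 0 := by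
  unfold pl
  rw [Finset.card_filter]
  push_cast
  refine Finset.sum_congr rfl fun y _ => ?_
  exact if_congr (by rw [sub_dotProduct, sub_eq_zero, eq_comm]) rfl rfl

lemma pl_sum (E : Finset (Fin 3 → ZMod p)) (ξ : Fin 3 → ZMod p) :
    ∑ t, (pl E ξ t : ℤ) = E.card := by
  unfold pl
  have := Finset.card_eq_sum_card_fiberwise (s := E) (t := univ) (f := fun x => x ⬝ᵥ ξ)
    (fun _ _ => mem_coe.2 (mem_univ _))
  exact_mod_cast this.symm

lemma Q_eq (E : Finset (Fin 3 → ZMod p)) (ξ : Fin 3 → ZMod p) :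
    Q E ξ = ∑ t, (pl E ξ t : ℤ) ^ 2 := by
  unfold Q
  simp only [← pl_eq]
  rw [← Finset.sum_fiberwise_of_maps_to (s := E) (t := univ) (g := fun x => x ⬝ᵥ ξ)
    (fun _ _ => mem_univ _)]
  refine Finset.sum_congr rfl fun t _ => ?_
  rw [Finset.sum_congr rfl (g := fun _ => (pl E ξ t : ℤ))]
  · simp [pl, sq]
  · intro x hx
    rw [(mem_filter.1 hx).2]

lemma Q_zero (E : Finset (Fin 3 → ZMod p)) : Q E 0 = (E.card : ℤ) ^ 2 := by
  simp [Q, sq]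

lemma Q_smul (E : Finset (Fin 3 → ZMod p)) (ξ : Fin 3 → ZMod p) {c : ZMod p} (hc : c ≠ 0) :
    Q E (c • ξ) = Q E ξ := by
  simp [Q, dotProduct_smul, hc]

lemma sum_S (E : Finset (Fin 3 → ZMod p)) (T : Finset (Fin 3 → ZMod p)) (h0 : 0 ∈ T) :
    ∑ ξ ∈ T, S E ξ = ∑ ξ ∈ T, Q E ξ - (E.card : ℤ) ^ 2 - (T.card - 1) * (p * (p - 2) ^ 2) := by
  rw [← Finset.add_sum_erase _ _ h0, ← Finset.add_sum_erase T (Q E) h0, Q_zero]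
  have h1 : ∑ ξ ∈ T.erase 0, S E ξ = ∑ ξ ∈ T.erase 0, (Q E ξ - p * (p - 2) ^ 2) := by
    refine Finset.sum_congr rfl fun ξ hξ => ?_
    rw [S, if_neg (Finset.ne_of_mem_erase hξ)]
  rw [h1, Finset.sum_sub_distrib, Finset.sum_const, Finset.card_erase_of_mem h0]
  have : 1 ≤ T.card := Finset.card_pos.2 ⟨0, h0⟩
  simp only [S, if_true, nsmul_eq_mul]
  push_cast [this]
  ring

lemma sumQ_perp (E : Finset (Fin 3 → ZMod p)) {v : Fin 3 → ZMod p} (hv : v ≠ 0) :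
    ∑ ξ ∈ univ.filter (fun ξ => v ⬝ᵥ ξ = 0), Q E ξ
      = p * (E.card : ℤ) ^ 2 + (p ^ 2 - p) * R E v := by
  unfold Q
  rw [Finset.sum_comm]
  have : ∀ x ∈ E, ∑ ξ ∈ univ.filter (fun ξ => v ⬝ᵥ ξ = 0),
      ∑ y ∈ E, (if (x - y) ⬝ᵥ ξ = 0 then (1 : ℤ) else 0)
      = p * E.card + (p ^ 2 - p) * nL E v x := by
    intro x _
    rw [Finset.sum_comm]
    have h2 : ∀ y ∈ E, ∑ ξ ∈ univ.filter (fun ξ => v ⬝ᵥ ξ = 0),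
      (if (x - y) ⬝ᵥ ξ = 0 then (1 : ℤ) else 0) =
        p + (p ^ 2 - p) * (if Par v (x - y) then 1 else 0) := by
      intro y _
      rw [Finset.sum_boole, Finset.filter_filter, card_perp2 hv]
      split_ifs
      · push_cast; ring
      · push_cast; ring
    rw [Finset.sum_congr rfl h2, Finset.sum_add_distrib, ← Finset.mul_sum, nL]
    simp
    ring
  rw [Finset.sum_congr rfl this, Finset.sum_add_distrib, R, Finset.mul_sum, Finset.sum_const,
    nsmul_eq_mul]
  ring

/-- planes through a point and a direction -/
lemma sum_pl_perp (E : Finset (Fin 3 → ZMod p)) {v : Fin 3 → ZMod p} (hv : v ≠ 0)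
    (x : Fin 3 → ZMod p) :
    ∑ ξ ∈ univ.filter (fun ξ => v ⬝ᵥ ξ = 0), (pl E ξ (x ⬝ᵥ ξ) : ℤ)
      = p * E.card + (p ^ 2 - p) * nL E v x := by
  simp only [pl_eq]
  rw [Finset.sum_comm]
  have h2 : ∀ y ∈ E, ∑ ξ ∈ univ.filter (fun ξ => v ⬝ᵥ ξ = 0),
    (if (x - y) ⬝ᵥ ξ = 0 then (1 : ℤ) else 0) =
      p + (p ^ 2 - p) * (if Par v (x - y) then 1 else 0) := by
    intro y _
    rw [Finset.sum_boole, Finset.filter_filter, card_perp2 hv]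
    split_ifs
    · push_cast; ring
    · push_cast; ring
  rw [Finset.sum_congr rfl h2, Finset.sum_add_distrib, ← Finset.mul_sum, nL]
  simp
  ring

lemma B_eq (E : Finset (Fin 3 → ZMod p)) (hE : (E.card : ℤ) = p * (p - 2))
    {v : Fin 3 → ZMod p} (hv : v ≠ 0) :
    B E v = (p - 1) * p * (2 * (p - 2) + tau E v) := by
  rw [B, sum_S _ _ (by simp), sumQ_perp E hv, card_perp1 hv, tau, if_neg hv, hE]
  push_cast
  ring

lemma sumQ (E : Finset (Fin 3 → ZMod p)) :
    ∑ ξ, Q E ξ = p ^ 2 * (E.card : ℤ) ^ 2 + (p ^ 3 - p ^ 2) * E.card := by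
  unfold Q
  rw [Finset.sum_comm]
  have : ∀ x ∈ E, ∑ ξ,
      ∑ y ∈ E, (if (x - y) ⬝ᵥ ξ = 0 then (1 : ℤ) else 0)
      = p ^ 2 * E.card + (p ^ 3 - p ^ 2) := by
    intro x hx
    rw [Finset.sum_comm]
    have h2 : ∀ y ∈ E, ∑ ξ,
      (if (x - y) ⬝ᵥ ξ = 0 then (1 : ℤ) else 0) =
        p ^ 2 + (p ^ 3 - p ^ 2) * (if x = y then 1 else 0) := by
      intro y _
      rw [Finset.sum_boole]
      split_ifs with h
      · subst h
        simp
      · rw [card_perp1 (sub_ne_zero.2 h)]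
        simp
    rw [Finset.sum_congr rfl h2, Finset.sum_add_distrib, ← Finset.mul_sum]
    simp [hx]
    ring
  rw [Finset.sum_congr rfl this]
  simp
  ring

lemma F_eq (E : Finset (Fin 3 → ZMod p)) (hE : (E.card : ℤ) = p * (p - 2)) :
    ∑ ξ, S E ξ = (p - 1) * p * (p - 2) * (p ^ 2 - p + 2) := by
  rw [sum_S _ _ (by simp), sumQ, hE]
  simp
  ring

lemma tau_pairs (E : Finset (Fin 3 → ZMod p)) (v : Fin 3 → ZMod p) :
    tau E v = ∑ x ∈ E, ∑ y ∈ E,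
      (if v ≠ 0 ∧ x ≠ y ∧ Par v (x - y) then (1 : ℤ) else 0) := by
  unfold tau
  split_ifs with hv
  · simp [hv]
  · rw [R, Finset.cast_card, ← Finset.sum_sub_distrib]
    refine Finset.sum_congr rfl fun x hx => ?_
    have hone : ∑ y ∈ E, (if x = y then (1 : ℤ) else 0) = 1 := by simp [hx]
    refine Eq.trans (b := nL E v x - ∑ y ∈ E, (if x = y then (1 : ℤ) else 0)) (by rw [hone]) ?_
    rw [nL, ← Finset.sum_sub_distrib]
    refine Finset.sum_congr rfl fun y hy => ?_
    by_cases hxy : x = y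
    · subst hxy
      have : Par v 0 := Submodule.zero_mem _
      simp [this]
    · simp [hxy, hv]

lemma sum_tau (E : Finset (Fin 3 → ZMod p)) :
    ∑ v, tau E v = (p - 1) * E.card * (E.card - 1) := by
  simp only [tau_pairs]
  rw [Finset.sum_comm]
  have : ∀ x ∈ E, ∑ v, ∑ y ∈ E,
      (if v ≠ 0 ∧ x ≠ y ∧ Par v (x - y) then (1 : ℤ) else 0) = (p - 1) * (E.card - 1) := by
    intro x hx
    rw [Finset.sum_comm]
    have h2 : ∀ y ∈ E, ∑ v, (if v ≠ 0 ∧ x ≠ y ∧ Par v (x - y) then (1 : ℤ) else 0)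
      = (p - 1) * (1 - if x = y then 1 else 0) := by
      intro y _
      by_cases hxy : x = y
      · simp [hxy]
      · rw [Finset.sum_boole]
        have hs : (univ.filter fun v => v ≠ 0 ∧ x ≠ y ∧ Par v (x - y))
            = (univ.filter fun v => Par (x - y) v).erase 0 := by
          ext v
          simp only [mem_filter, mem_univ, true_and, mem_erase]
          constructor
          · rintro ⟨h1, h2, h3⟩
            exact ⟨h1, par_symm (sub_ne_zero.2 hxy) h3⟩
          · rintro ⟨h1, h2⟩
            exact ⟨h1, hxy, par_symm h1 h2⟩
        rw [hs, Finset.card_erase_of_mem, card_par (sub_ne_zero.2 hxy)]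
        · have := hp.out.one_lt
          push_cast [this.le]
          simp [hxy]
        · have : Par (x - y) 0 := Submodule.zero_mem _
          simp [this]
    rw [Finset.sum_congr rfl h2, ← Finset.mul_sum, Finset.sum_sub_distrib]
    simp [hx]
  rw [Finset.sum_congr rfl this]
  simp
  ring

lemma sum_B_sq (E : Finset (Fin 3 → ZMod p)) :
    ∑ v, B E v ^ 2 = p * (∑ ξ, S E ξ) ^ 2 + (p ^ 2 - p) * (p - 1) * ∑ ξ, S E ξ ^ 2 := by
  have h1 : ∀ v, B E v ^ 2 = ∑ ξ, ∑ η, S E ξ * S E η *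
      (if ξ ⬝ᵥ v = 0 ∧ η ⬝ᵥ v = 0 then 1 else 0) := by
    intro v
    rw [sq, B, Finset.sum_filter, Finset.sum_mul_sum]
    refine Finset.sum_congr rfl fun ξ _ => Finset.sum_congr rfl fun η _ => ?_
    rw [dotProduct_comm v, dotProduct_comm v]
    split_ifs <;> simp_all
  simp only [h1]
  rw [Finset.sum_comm]
  have h2 : ∀ ξ, ∑ v, ∑ η, S E ξ * S E η *
      (if ξ ⬝ᵥ v = 0 ∧ η ⬝ᵥ v = 0 then 1 else 0)
      = p * S E ξ * (∑ η, S E η) + (p ^ 2 - p) * (p - 1) * S E ξ ^ 2 := by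
    intro ξ
    by_cases hξ : ξ = 0
    · simp [S, hξ]
    rw [Finset.sum_comm]
    have h3 : ∀ η, ∑ v, S E ξ * S E η *
      (if ξ ⬝ᵥ v = 0 ∧ η ⬝ᵥ v = 0 then 1 else 0)
      = p * S E ξ * S E η + (p ^ 2 - p) * S E ξ * (if Par ξ η then S E η else 0) := by
      intro η
      rw [← Finset.mul_sum, Finset.sum_boole, card_perp2 hξ]
      split_ifs
      · push_cast; ring
      · ring
    simp only [h3]
    rw [Finset.sum_add_distrib, ← Finset.mul_sum, ← Finset.mul_sum, ← Finset.sum_filter]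
    have h4 : ∑ η ∈ univ.filter (fun η => Par ξ η), S E η = (p - 1) * S E ξ := by
      have h0 : (0 : Fin 3 → ZMod p) ∈ univ.filter (fun η => Par ξ η) := by
        have : Par ξ 0 := Submodule.zero_mem _
        simp [this]
      rw [← Finset.add_sum_erase _ _ h0]
      have h5 : ∀ η ∈ (univ.filter (fun η => Par ξ η)).erase 0, S E η = S E ξ := by
        intro η hη
        rw [mem_erase, mem_filter] at hη
        obtain ⟨h6, -, h7⟩ := hη
        obtain ⟨c, rfl⟩ := Submodule.mem_span_singleton.1 h7
        have hc : c ≠ 0 := by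
          rintro rfl
          simp at h6
        simp only [S, h6, hξ, if_false, Q_smul E ξ hc]
      rw [Finset.sum_congr rfl h5, Finset.sum_const, Finset.card_erase_of_mem h0, card_par hξ]
      have := hp.out.one_lt
      simp only [S, if_true, nsmul_eq_mul]
      push_cast [this.le]
      ring
    rw [h4]
    ring
  simp only [h2]
  rw [Finset.sum_add_distrib, ← Finset.mul_sum, ← Finset.sum_mul, ← Finset.mul_sum]
  ring

end sums

section structural
variable {p : ℕ} [hp : Fact p.Prime]

lemma par_refl_sub (v x : Fin 3 → ZMod p) : Par v (x - x) := by
  rw [sub_self]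
  exact Submodule.zero_mem _

lemma nL_ge {E : Finset (Fin 3 → ZMod p)} (v : Fin 3 → ZMod p) {x : Fin 3 → ZMod p} (hx : x ∈ E) :
    1 ≤ nL E v x := by
  unfold nL
  rw [← Finset.add_sum_erase _ _ hx, if_pos (par_refl_sub v x)]
  have : 0 ≤ ∑ y ∈ E.erase x, if Par v (x - y) then (1 : ℤ) else 0 :=
    Finset.sum_nonneg fun y _ => by split_ifs <;> norm_num
  linarith

lemma tau_nonneg (E : Finset (Fin 3 → ZMod p)) (v : Fin 3 → ZMod p) : 0 ≤ tau E v := by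
  unfold tau
  split_ifs
  · exact le_rfl
  · rw [R, Finset.cast_card, ← Finset.sum_sub_distrib]
    refine Finset.sum_nonneg fun x hx => ?_
    have := nL_ge v hx
    simpa using this

lemma exists_of_tau (E : Finset (Fin 3 → ZMod p)) (v : Fin 3 → ZMod p) (h : tau E v ≠ 0) :
    v ≠ 0 ∧ ∃ x ∈ E, ∃ y ∈ E, x ≠ y ∧ Par v (x - y) := by
  have hv : v ≠ 0 := by
    rintro rfl
    simp [tau] at h
  refine ⟨hv, ?_⟩
  by_contra! hcon
  apply h
  rw [tau, if_neg hv, R, Finset.cast_card, ← Finset.sum_sub_distrib]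
  refine Finset.sum_eq_zero fun x hx => ?_
  rw [nL, Finset.sum_eq_single x]
  · rw [if_pos (par_refl_sub v x), sub_self]
  · intro y hy hyx
    rw [if_neg (hcon x hx y hy hyx.symm)]
  · intro h; exact absurd hx h

lemma S_nonneg (E : Finset (Fin 3 → ZMod p)) (hE : (E.card : ℤ) = p * (p - 2))
    (ξ : Fin 3 → ZMod p) : 0 ≤ S E ξ := by
  unfold S
  split_ifs
  · exact le_rfl
  rw [Q_eq]
  have h := sq_sum_le_card_mul_sum_sq (s := (univ : Finset (ZMod p))) (f := fun t => (pl E ξ t : ℤ))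
  rw [pl_sum, hE, Finset.card_univ, ZMod.card] at h
  have hp0 : (0 : ℤ) < p := by exact_mod_cast hp.out.pos
  have : (p : ℤ) * (p * (p - 2) ^ 2) ≤ p * ∑ t, (pl E ξ t : ℤ) ^ 2 := by
    refine le_trans (le_of_eq ?_) h
    ring
  have := le_of_mul_le_mul_left this hp0
  linarith

lemma pl_of_eqd {E : Finset (Fin 3 → ZMod p)} (hE : (E.card : ℤ) = p * (p - 2))
    {v : Fin 3 → ZMod p} (h : Eqd E v) (t : ZMod p) : (pl E v t : ℤ) = p - 2 := by
  have h1 := pl_sum E v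
  rw [Finset.sum_congr rfl (g := fun _ => (pl E v t : ℤ)) (fun s _ => by rw [h s t]), hE] at h1
  simp only [Finset.sum_const, Finset.card_univ, ZMod.card, nsmul_eq_mul] at h1
  have hp0 : (p : ℤ) ≠ 0 := by exact_mod_cast hp.out.ne_zero
  exact mul_left_cancel₀ hp0 h1

lemma S_of_eqd {E : Finset (Fin 3 → ZMod p)} (hE : (E.card : ℤ) = p * (p - 2))
    {v : Fin 3 → ZMod p} (h : Eqd E v) : S E v = 0 := by
  unfold S
  split_ifs
  · rfl
  rw [Q_eq]
  simp only [pl_of_eqd hE h]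
  simp

lemma eqd_of_S {E : Finset (Fin 3 → ZMod p)} (hE : (E.card : ℤ) = p * (p - 2))
    {v : Fin 3 → ZMod p} (hv : v ≠ 0) (h : S E v = 0) (t : ZMod p) : (pl E v t : ℤ) = p - 2 := by
  rw [S, if_neg hv, Q_eq] at h
  have h1 : ∑ t, ((pl E v t : ℤ) - (p - 2)) ^ 2 = 0 := by
    have : ∀ t, ((pl E v t : ℤ) - (p - 2)) ^ 2 = (pl E v t : ℤ) ^ 2 - 2 * (p - 2) * pl E v t
      + (p - 2) ^ 2 := fun t => by ring
    simp only [this]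
    rw [Finset.sum_add_distrib, Finset.sum_sub_distrib, ← Finset.mul_sum, pl_sum, hE]
    simp only [Finset.sum_const, Finset.card_univ, ZMod.card, nsmul_eq_mul]
    linarith
  have h2 := (Finset.sum_eq_zero_iff_of_nonneg (fun t _ => sq_nonneg _)).1 h1 t (mem_univ _)
  have := pow_eq_zero_iff (two_ne_zero) |>.1 h2
  linarith

lemma eqd_of_tau {E A : Finset (Fin 3 → ZMod p)}
    (h : ∀ x ∈ E, ∀ y ∈ E, x ≠ y → Eqd A (x - y)) {v : Fin 3 → ZMod p} (hv : v ≠ 0)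
    {x y : Fin 3 → ZMod p} (hx : x ∈ E) (hy : y ∈ E) (hxy : x ≠ y) (hpar : Par v (x - y)) :
    Eqd A v := by
  obtain ⟨c, hc⟩ := Submodule.mem_span_singleton.1 (par_symm (sub_ne_zero.2 hxy) hpar)
  rw [← hc]
  refine (h x hx y hy hxy).smul ?_
  rintro rfl
  apply hv
  rw [← hc, zero_smul]

lemma pl_le {E A : Finset (Fin 3 → ZMod p)} (h5 : 5 ≤ p)
    (hA : (A.card : ℤ) = p * (p - 2))
    (h : ∀ x ∈ E, ∀ y ∈ E, x ≠ y → Eqd A (x - y)) {ξ : Fin 3 → ZMod p} (hξ : ξ ≠ 0) (t : ZMod p) :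
    pl E ξ t ≤ p := by
  by_contra! hlt
  have hclaim : ∀ v ∈ univ.filter (fun v => ξ ⬝ᵥ v = 0), S A v = 0 := by
    intro v hv
    rw [mem_filter] at hv
    replace hv := hv.2
    by_cases hv0 : v = 0
    · simp [S, hv0]
    obtain ⟨η, hη1, hη2⟩ : ∃ η, v ⬝ᵥ η = 0 ∧ ¬ Par ξ η := by
      by_contra! hcon
      have hsub : univ.filter (fun η => v ⬝ᵥ η = 0) ⊆ univ.filter (fun η => Par ξ η) := by
        intro η hη
        rw [mem_filter] at hη ⊢
        exact ⟨hη.1, hcon η hη.2⟩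
      have := Finset.card_le_card hsub
      rw [card_perp1 hv0, card_par hξ] at this
      nlinarith
    obtain ⟨x, hx, y, hy, hxy, hxyη⟩ := Finset.exists_ne_map_eq_of_card_lt_of_maps_to
      (s := E.filter (fun x => x ⬝ᵥ ξ = t)) (t := (univ : Finset (ZMod p)))
      (f := fun x => x ⬝ᵥ η) (by rw [Finset.card_univ, ZMod.card]; exact hlt)
      (fun _ _ => mem_coe.2 (mem_univ _))
    rw [mem_filter] at hx hy
    have hsub : univ.filter (fun z => Par v z) ⊆
        univ.filter (fun z => ξ ⬝ᵥ z = 0 ∧ η ⬝ᵥ z = 0) := by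
      intro z hz
      rw [mem_filter] at hz ⊢
      obtain ⟨c, rfl⟩ := Submodule.mem_span_singleton.1 hz.2
      refine ⟨hz.1, ?_, ?_⟩
      · rw [dotProduct_smul, hv, smul_zero]
      · rw [dotProduct_smul, dotProduct_comm, hη1, smul_zero]
    have heq := Finset.eq_of_subset_of_card_le hsub (by
      rw [card_perp2 hξ, card_par hv0, if_neg hη2])
    have hmem : x - y ∈ univ.filter (fun z => Par v z) := by
      rw [heq, mem_filter]
      refine ⟨mem_univ _, ?_, ?_⟩
      · rw [dotProduct_comm, sub_dotProduct, hx.2, hy.2, sub_self]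
      · rw [dotProduct_comm, sub_dotProduct, sub_eq_zero]
        exact hxyη
    exact S_of_eqd hA (eqd_of_tau h hv0 hx.1 hy.1 hxy (mem_filter.1 hmem).2)
  have h1 := B_eq A hA hξ
  rw [B, Finset.sum_eq_zero hclaim] at h1
  have h2 := tau_nonneg A ξ
  have h5' : (5 : ℤ) ≤ p := by exact_mod_cast h5
  have : 0 < ((p : ℤ) - 1) * p * (2 * (p - 2) + tau A ξ) := by
    apply mul_pos
    · apply mul_pos <;> linarith
    · linarith
  linarith

lemma S_le {E : Finset (Fin 3 → ZMod p)} (h5 : 5 ≤ p) (hE : (E.card : ℤ) = p * (p - 2))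
    (hpl : ∀ ξ : Fin 3 → ZMod p, ξ ≠ 0 → ∀ t, pl E ξ t ≤ p) (ξ : Fin 3 → ZMod p) :
    S E ξ ≤ 2 * p * (p - 2) := by
  have h5' : (5 : ℤ) ≤ p := by exact_mod_cast h5
  unfold S
  split_ifs with h
  · apply mul_nonneg <;> linarith
  rw [Q_eq]
  have h1 : ∑ t, (pl E ξ t : ℤ) ^ 2 ≤ ∑ t, p * (pl E ξ t : ℤ) := by
    refine Finset.sum_le_sum fun t _ => ?_
    rw [sq]
    have : (pl E ξ t : ℤ) ≤ p := by exact_mod_cast hpl ξ h t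
    gcongr
  rw [← Finset.mul_sum, pl_sum, hE] at h1
  linarith

lemma tau_sq (E : Finset (Fin 3 → ZMod p)) (hE : (E.card : ℤ) = p * (p - 2)) :
    ((p : ℤ) - 1) ^ 2 * p ^ 2 * (∑ v, tau E v ^ 2 + 4 * (p - 2) * ∑ v, tau E v
      + 4 * (p - 2) ^ 2 * (p ^ 3 - 1))
    = (p - 1) * (∑ ξ, S E ξ) ^ 2 + (p ^ 2 - p) * (p - 1) * ∑ ξ, S E ξ ^ 2 := by
  have h := sum_B_sq E
  rw [← Finset.add_sum_erase _ _ (mem_univ (0 : Fin 3 → ZMod p))] at h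
  have h0 : B E 0 = ∑ ξ, S E ξ := by simp [B]
  have h1 : ∑ v ∈ univ.erase (0 : Fin 3 → ZMod p), B E v ^ 2
    = ∑ v ∈ univ.erase (0 : Fin 3 → ZMod p), (((p : ℤ) - 1) ^ 2 * p ^ 2 * (tau E v ^ 2)
      + ((p : ℤ) - 1) ^ 2 * p ^ 2 * (4 * (p - 2)) * tau E v
      + ((p : ℤ) - 1) ^ 2 * p ^ 2 * (4 * (p - 2) ^ 2)) := by
    refine Finset.sum_congr rfl fun v hv => ?_
    rw [B_eq E hE (Finset.ne_of_mem_erase hv)]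
    ring
  have ht0 : tau E 0 = 0 := by simp [tau]
  have h2 : ∑ v ∈ univ.erase (0 : Fin 3 → ZMod p), tau E v = ∑ v, tau E v := by
    rw [← Finset.add_sum_erase _ _ (mem_univ (0 : Fin 3 → ZMod p)), ht0, zero_add]
  have h3 : ∑ v ∈ univ.erase (0 : Fin 3 → ZMod p), tau E v ^ 2 = ∑ v, tau E v ^ 2 := by
    rw [← Finset.add_sum_erase univ _ (mem_univ (0 : Fin 3 → ZMod p)), ht0]
    simp
  have h4 : (((univ.erase (0 : Fin 3 → ZMod p)).card : ℕ) : ℤ) = p ^ 3 - 1 := by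
    rw [Finset.card_erase_of_mem (mem_univ _), Finset.card_univ]
    have : 1 ≤ p ^ 3 := Nat.one_le_pow _ _ hp.out.pos
    simp [ZMod.card, Fintype.card_pi, this]
  rw [Finset.sum_add_distrib, Finset.sum_add_distrib, ← Finset.mul_sum, ← Finset.mul_sum,
    Finset.sum_const, nsmul_eq_mul, h2, h3, h4] at h1
  rw [h0, h1] at h
  linarith

lemma tau_sq_le (E : Finset (Fin 3 → ZMod p)) (h5 : 5 ≤ p) (hE : (E.card : ℤ) = p * (p - 2))
    (hpl : ∀ ξ : Fin 3 → ZMod p, ξ ≠ 0 → ∀ t, pl E ξ t ≤ p) :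
    ∑ v, tau E v ^ 2 ≤ (p - 1) * (p - 2) ^ 2 * p ^ 2 * (p ^ 2 - 4 * p + 7) := by
  have h5' : (5 : ℤ) ≤ p := by exact_mod_cast h5
  have h := tau_sq E hE
  have hS : ∑ ξ, S E ξ ^ 2 ≤ 2 * p * (p - 2) * ∑ ξ, S E ξ := by
    rw [Finset.mul_sum]
    refine Finset.sum_le_sum fun ξ _ => ?_
    rw [sq]
    exact mul_le_mul_of_nonneg_right (S_le h5 hE hpl ξ) (S_nonneg E hE ξ)
  rw [sum_tau, F_eq E hE, hE] at h
  rw [F_eq E hE] at hS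
  have hpos : (0 : ℤ) < (p - 1) ^ 2 * p ^ 2 := by
    apply mul_pos <;> apply pow_pos <;> linarith
  refine le_of_mul_le_mul_left ?_ hpos
  have hc : (0 : ℤ) ≤ (p ^ 2 - p) * (p - 1) := by
    apply mul_nonneg <;> nlinarith
  have := mul_le_mul_of_nonneg_left hS hc
  linarith

lemma S_tau {E A : Finset (Fin 3 → ZMod p)} (hA : (A.card : ℤ) = p * (p - 2))
    (h : ∀ x ∈ E, ∀ y ∈ E, x ≠ y → Eqd A (x - y)) {v : Fin 3 → ZMod p} (hv : tau E v ≠ 0) :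
    S A v = 0 := by
  obtain ⟨hv0, x, hx, y, hy, hxy, hpar⟩ := exists_of_tau E v hv
  exact S_of_eqd hA (eqd_of_tau h hv0 hx hy hxy hpar)

lemma cauchy (E : Finset (Fin 3 → ZMod p)) :
    (∑ v, tau E v) ^ 2 ≤ (univ.filter (fun v => tau E v ≠ 0)).card * ∑ v, tau E v ^ 2 := by
  have h := sq_sum_le_card_mul_sum_sq (s := univ.filter (fun v => tau E v ≠ 0)) (f := tau E)
  rw [Finset.sum_filter_ne_zero] at h
  refine h.trans ?_
  gcongr
  · exact Finset.filter_subset _ _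

lemma D_le {E A : Finset (Fin 3 → ZMod p)} (h5 : 5 ≤ p)
    (hA : (A.card : ℤ) = p * (p - 2))
    (hpl : ∀ ξ : Fin 3 → ZMod p, ξ ≠ 0 → ∀ t, pl A ξ t ≤ p)
    (h : ∀ x ∈ E, ∀ y ∈ E, x ≠ y → Eqd A (x - y)) :
    2 * ((univ.filter (fun v => tau E v ≠ 0)).card : ℤ) ≤ (p - 1) * (p ^ 2 + 3 * p) := by
  have h5' : (5 : ℤ) ≤ p := by exact_mod_cast h5
  have h1 : ∑ ξ, S A ξ ≤ (univ.filter (fun v => S A v ≠ 0)).card * (2 * p * (p - 2)) := by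
    rw [← Finset.sum_filter_ne_zero, ← nsmul_eq_mul]
    exact Finset.sum_le_card_nsmul _ _ _ fun ξ _ => S_le h5 hA hpl ξ
  rw [F_eq A hA] at h1
  have hpos : (0 : ℤ) < p * (p - 2) := by apply mul_pos <;> linarith
  have h2 : ((p : ℤ) - 1) * (p ^ 2 - p + 2) ≤ 2 * (univ.filter (fun v => S A v ≠ 0)).card := by
    refine le_of_mul_le_mul_left ?_ hpos
    linarith
  have hdisj : Disjoint (univ.filter (fun v => tau E v ≠ 0)) (univ.filter (fun v => S A v ≠ 0)) := by
    rw [Finset.disjoint_left]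
    intro v hv hv2
    rw [mem_filter] at hv hv2
    exact hv2.2 (S_tau hA h hv.2)
  have hsub : (univ.filter (fun v => tau E v ≠ 0)) ∪ (univ.filter (fun v => S A v ≠ 0)) ⊆
      univ.erase (0 : Fin 3 → ZMod p) := by
    intro v hv
    rw [mem_erase]
    refine ⟨?_, mem_univ _⟩
    rintro rfl
    simp [tau, S] at hv
  have h3 := Finset.card_le_card hsub
  rw [Finset.card_union_of_disjoint hdisj] at h3
  have h4 : (((univ.erase (0 : Fin 3 → ZMod p)).card : ℕ) : ℤ) = p ^ 3 - 1 := by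
    rw [Finset.card_erase_of_mem (mem_univ _), Finset.card_univ]
    have : 1 ≤ p ^ 3 := Nat.one_le_pow _ _ hp.out.pos
    simp [ZMod.card, Fintype.card_pi, this]
  have h5 : ((univ.filter (fun v => tau E v ≠ 0)).card : ℤ)
     + (univ.filter (fun v => S A v ≠ 0)).card ≤ p ^ 3 - 1 := by
    rw [← h4]
    exact_mod_cast h3
  nlinarith

lemma large_p {E A : Finset (Fin 3 → ZMod p)} (h7 : 7 ≤ p)
    (hE : (E.card : ℤ) = p * (p - 2)) (hA : (A.card : ℤ) = p * (p - 2))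
    (h : ∀ x ∈ E, ∀ y ∈ E, x ≠ y → Eqd A (x - y))
    (h' : ∀ x ∈ A, ∀ y ∈ A, x ≠ y → Eqd E (x - y)) : False := by
  have h5 : 5 ≤ p := by omega
  have h7' : (7 : ℤ) ≤ p := by exact_mod_cast h7
  have h1 := cauchy E
  have h2 := D_le h5 hA (fun ξ hξ t => pl_le h5 hE h' hξ t) h
  have h3 := tau_sq_le E h5 hE (fun ξ hξ t => pl_le h5 hA h hξ t)
  rw [sum_tau, hE] at h1
  have h4 : 2 * (((p : ℤ) - 1) * (p * (p - 2)) * (p * (p - 2) - 1)) ^ 2 ≤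
    (p - 1) * (p ^ 2 + 3 * p) * ((p - 1) * (p - 2) ^ 2 * p ^ 2 * (p ^ 2 - 4 * p + 7)) := by
    calc _ ≤ 2 * (((univ.filter (fun v => tau E v ≠ 0)).card : ℤ) * ∑ v, tau E v ^ 2) := by linarith
      _ = (2 * ((univ.filter (fun v => tau E v ≠ 0)).card : ℤ)) * ∑ v, tau E v ^ 2 := by ring
      _ ≤ _ := by
        apply mul_le_mul h2 h3
        · exact Finset.sum_nonneg fun v _ => sq_nonneg _
        · apply mul_nonneg <;> nlinarith
  have hpos : (0 : ℤ) < (p - 1) ^ 2 * (p - 2) ^ 2 * p ^ 2 := by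
    apply mul_pos
    · apply mul_pos <;> apply pow_pos <;> linarith
    · apply pow_pos; linarith
  have h6 : 2 * ((p : ℤ) * (p - 2) - 1) ^ 2 ≤ (p ^ 2 + 3 * p) * (p ^ 2 - 4 * p + 7) := by
    refine le_of_mul_le_mul_left ?_ hpos
    linarith
  obtain ⟨q, hq⟩ : ∃ q : ℤ, (p : ℤ) = q + 7 := ⟨p - 7, by ring⟩
  have hq0 : 0 ≤ q := by linarith
  rw [hq] at h6
  have := pow_nonneg hq0 2
  have := pow_nonneg hq0 3
  have := pow_nonneg hq0 4
  ring_nf at h6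
  linarith

end structural

section five
variable {p : ℕ} [hp : Fact p.Prime]

/-- moments -/
def mom (E : Finset (Fin 3 → ZMod p)) (k : ℕ) (ξ : Fin 3 → ZMod p) : ZMod p :=
  ∑ x ∈ E, (x ⬝ᵥ ξ) ^ k

lemma mom_eq (E : Finset (Fin 3 → ZMod p)) (k : ℕ) (ξ : Fin 3 → ZMod p) :
    mom E k ξ = ∑ t, (pl E ξ t : ZMod p) * t ^ k := by
  unfold mom
  rw [← Finset.sum_fiberwise_of_maps_to (s := E) (t := univ) (g := fun x => x ⬝ᵥ ξ)
    (fun _ _ => mem_univ _)]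
  refine Finset.sum_congr rfl fun t _ => ?_
  rw [Finset.sum_congr rfl (g := fun _ => t ^ k)]
  · simp [pl]
  · intro x hx
    rw [(mem_filter.1 hx).2]

lemma mom_zero (E : Finset (Fin 3 → ZMod p)) (k : ℕ)
    (h : k * p ^ 2 < (univ.filter (fun ξ => mom E k ξ = 0)).card) (ξ : Fin 3 → ZMod p) :
    mom E k ξ = 0 := by
  let P : MvPolynomial (Fin 3) (ZMod p) :=
    ∑ x ∈ E, (∑ i, MvPolynomial.C (x i) * MvPolynomial.X i) ^ k
  have hev : ∀ ξ, MvPolynomial.eval ξ P = mom E k ξ := by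
    intro ξ
    simp [P, mom, dotProduct]
  have hdeg : P.totalDegree ≤ k := by
    refine MvPolynomial.totalDegree_finsetSum_le fun x _ => ?_
    refine (MvPolynomial.totalDegree_pow _ _).trans ?_
    have : (∑ i, MvPolynomial.C (x i) * MvPolynomial.X i :
        MvPolynomial (Fin 3) (ZMod p)).totalDegree ≤ 1 := by
      refine MvPolynomial.totalDegree_finsetSum_le fun i _ => ?_
      refine (MvPolynomial.totalDegree_mul _ _).trans ?_
      simp
    nlinarith
  by_cases hP : P = 0
  · rw [← hev, hP, map_zero]
  exfalso
  have hsz := MvPolynomial.schwartz_zippel_totalDegree hP (univ : Finset (ZMod p))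
  simp only [hev, Fintype.piFinset_univ, Finset.card_univ, ZMod.card] at hsz
  have hp0 : (0 : ℚ≥0) < p := by exact_mod_cast hp.out.pos
  rw [div_le_div_iff₀ (by positivity) hp0] at hsz
  have hsz' : (univ.filter (fun ξ => mom E k ξ = 0)).card * p ≤ P.totalDegree * p ^ 3 := by
    exact_mod_cast hsz
  have h1 : P.totalDegree * p ^ 3 ≤ k * p ^ 3 := Nat.mul_le_mul_right _ hdeg
  have h2 := Nat.mul_lt_mul_of_pos_right h hp.out.pos
  nlinarith

lemma finite_check_aux : ∀ b c d e : Fin 6,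
    (b.val + 2 * c.val + 3 * d.val + 4 * e.val) % 5 = 0 →
    (b.val + 4 * c.val + 9 * d.val + 16 * e.val) % 5 = 0 →
    10 ≤ b.val + c.val + d.val + e.val → b.val + c.val + d.val + e.val ≤ 15 →
    ((15 - (b.val + c.val + d.val + e.val)) ^ 2
        + b.val ^ 2 + c.val ^ 2 + d.val ^ 2 + e.val ^ 2 = 55 ∧
      (b.val + 8 * c.val + 27 * d.val + 64 * e.val) % 5 ≠ 0) ∨
    (((15 - (b.val + c.val + d.val + e.val)) ^ 2
        + b.val ^ 2 + c.val ^ 2 + d.val ^ 2 + e.val ^ 2 = 45 ∨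
      (15 - (b.val + c.val + d.val + e.val)) ^ 2
        + b.val ^ 2 + c.val ^ 2 + d.val ^ 2 + e.val ^ 2 = 75) ∧
      (b.val + 8 * c.val + 27 * d.val + 64 * e.val) % 5 = 0) := by
  decide +kernel

lemma finite_check : ∀ a b c d e : Fin 6, a.val + b.val + c.val + d.val + e.val = 15 →
    (b.val + 2 * c.val + 3 * d.val + 4 * e.val) % 5 = 0 →
    (b.val + 4 * c.val + 9 * d.val + 16 * e.val) % 5 = 0 →
    (a.val ^ 2 + b.val ^ 2 + c.val ^ 2 + d.val ^ 2 + e.val ^ 2 = 55 ∧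
      (b.val + 8 * c.val + 27 * d.val + 64 * e.val) % 5 ≠ 0) ∨
    ((a.val ^ 2 + b.val ^ 2 + c.val ^ 2 + d.val ^ 2 + e.val ^ 2 = 45 ∨
      a.val ^ 2 + b.val ^ 2 + c.val ^ 2 + d.val ^ 2 + e.val ^ 2 = 75) ∧
      (b.val + 8 * c.val + 27 * d.val + 64 * e.val) % 5 = 0) := by
  intro a b c d e hs h1 h2
  have ha := a.isLt
  have h := finite_check_aux b c d e h1 h2 (by omega) (by omega)
  have he : 15 - (b.val + c.val + d.val + e.val) = a.val := by omega
  rwa [he] at h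

lemma tau_even (E : Finset (Fin 3 → ZMod p)) (v : Fin 3 → ZMod p) : (2 : ℤ) ∣ tau E v := by
  have h : ((tau E v : ℤ) : ZMod 2) = 0 := by
    rw [tau_pairs]
    push_cast
    rw [← Finset.sum_product']
    refine Finset.sum_involution (fun z _ => (z.2, z.1)) ?_ ?_ ?_ ?_
    · rintro ⟨x, y⟩ hz
      have : (v ≠ 0 ∧ y ≠ x ∧ Par v (y - x)) ↔ (v ≠ 0 ∧ x ≠ y ∧ Par v (x - y)) := by
        have h1 : Par v (y - x) ↔ Par v (x - y) := by
          rw [← neg_sub x y]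
          exact Submodule.neg_mem_iff _
        rw [h1, ne_comm (a := y)]
      simp only [this]
      exact CharTwo.add_self_eq_zero _
    · rintro ⟨x, y⟩ hz hne heq
      simp only [Prod.mk.injEq] at heq
      simp [heq.1] at hne
    · rintro ⟨x, y⟩ hz
      rw [mem_product] at hz ⊢
      exact ⟨hz.2, hz.1⟩
    · rintro ⟨x, y⟩ hz
      rfl
  exact_mod_cast (ZMod.intCast_zmod_eq_zero_iff_dvd _ 2).1 h

lemma tau_smul (E : Finset (Fin 3 → ZMod p)) (v : Fin 3 → ZMod p) {c : ZMod p} (hc : c ≠ 0) :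
    tau E (c • v) = tau E v := by
  have : ∀ z, Par (c • v) z ↔ Par v z := by
    intro z
    unfold Par
    rw [Submodule.span_singleton_smul_eq (IsUnit.mk0 c hc)]
  simp only [tau_pairs, this, ne_eq, smul_eq_zero, hc, false_or]

end five

section finale
variable [hp : Fact (Nat.Prime 5)]

lemma sum5 {M : Type*} [AddCommMonoid M] (f : ZMod 5 → M) :
    ∑ t, f t = f 0 + f 1 + f 2 + f 3 + f 4 :=
  Fin.sum_univ_five f

lemma card_univ5 : (univ : Finset (Fin 3 → ZMod 5)).card = 125 := by
  rw [Finset.card_univ]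
  simp [ZMod.card, Fintype.card_pi]

lemma trich {E : Finset (Fin 3 → ZMod 5)} (hE : (E.card : ℤ) = 15) {ξ : Fin 3 → ZMod 5}
    (hξ : ξ ≠ 0) (hpl : ∀ t, pl E ξ t ≤ 5) (m1 : mom E 1 ξ = 0) (m2 : mom E 2 ξ = 0) :
    (S E ξ = 10 ∧ mom E 3 ξ ≠ 0) ∨ ((S E ξ = 0 ∨ S E ξ = 30) ∧ mom E 3 ξ = 0) := by
  have hs := pl_sum E ξ
  have hS : S E ξ = Q E ξ - 45 := by
    rw [S, if_neg hξ]
    norm_num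
  rw [hS, Q_eq]
  rw [mom_eq] at m1 m2
  rw [mom_eq]
  rw [sum5] at m1 m2 hs
  rw [sum5, sum5]
  have ha := hpl 0
  have hb := hpl 1
  have hc := hpl 2
  have hd := hpl 3
  have he := hpl 4
  clear hpl
  generalize pl E ξ 0 = a at *
  generalize pl E ξ 1 = b at *
  generalize pl E ξ 2 = c at *
  generalize pl E ξ 3 = d at *
  generalize pl E ξ 4 = e at *
  have e1 : (b : ZMod 5) * 1 ^ 1 + c * 2 ^ 1 + d * 3 ^ 1 + e * 4 ^ 1
      = ((b + 2 * c + 3 * d + 4 * e : ℕ) : ZMod 5) := by push_cast; ring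
  have e2 : (b : ZMod 5) * 1 ^ 2 + c * 2 ^ 2 + d * 3 ^ 2 + e * 4 ^ 2
      = ((b + 4 * c + 9 * d + 16 * e : ℕ) : ZMod 5) := by push_cast; ring
  have e3 : (a : ZMod 5) * 0 ^ 3 + b * 1 ^ 3 + c * 2 ^ 3 + d * 3 ^ 3 + e * 4 ^ 3
      = ((b + 8 * c + 27 * d + 64 * e : ℕ) : ZMod 5) := by push_cast; ring
  have m1' : ((b + 2 * c + 3 * d + 4 * e : ℕ) : ZMod 5) = 0 := by
    rw [← e1, ← m1]; ring
  have m2' : ((b + 4 * c + 9 * d + 16 * e : ℕ) : ZMod 5) = 0 := by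
    rw [← e2, ← m2]; ring
  rw [e3]
  simp only [ne_eq, ZMod.natCast_eq_zero_iff, Nat.dvd_iff_mod_eq_zero] at m1' m2' ⊢
  have hsum : a + b + c + d + e = 15 := by
    rw [hE] at hs
    exact_mod_cast hs
  have key := finite_check ⟨a, by omega⟩ ⟨b, by omega⟩ ⟨c, by omega⟩ ⟨d, by omega⟩ ⟨e, by omega⟩
    hsum m1' m2'
  simp only at key
  rcases key with ⟨k1, k2⟩ | ⟨k1, k2⟩
  · left
    refine ⟨?_, k2⟩
    have : ((a ^ 2 + b ^ 2 + c ^ 2 + d ^ 2 + e ^ 2 : ℕ) : ℤ) = 55 := by rw [k1]; rfl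
    push_cast at this
    linarith
  · right
    refine ⟨?_, k2⟩
    rcases k1 with k1 | k1
    · left
      have : ((a ^ 2 + b ^ 2 + c ^ 2 + d ^ 2 + e ^ 2 : ℕ) : ℤ) = 45 := by rw [k1]; rfl
      push_cast at this
      linarith
    · right
      have : ((a ^ 2 + b ^ 2 + c ^ 2 + d ^ 2 + e ^ 2 : ℕ) : ℤ) = 75 := by rw [k1]; rfl
      push_cast at this
      linarith

lemma mom_of_S {E : Finset (Fin 3 → ZMod 5)} (hE : (E.card : ℤ) = (5 : ℕ) * ((5 : ℕ) - 2))
    {ξ : Fin 3 → ZMod 5} (hS : S E ξ = 0) : mom E 1 ξ = 0 ∧ mom E 2 ξ = 0 := by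
  by_cases hξ : ξ = 0
  · subst hξ
    simp [mom]
  · have h3 : ∀ t, pl E ξ t = 3 := by
      intro t
      have := eqd_of_S hE hξ hS t
      push_cast at this
      omega
    simp only [mom_eq, h3]
    rw [sum5, sum5]
    constructor
    · have : ((30 : ℕ) : ZMod 5) = 0 := (ZMod.natCast_eq_zero_iff 30 5).2 (by norm_num)
      push_cast at this ⊢
      linear_combination this
    · have : ((90 : ℕ) : ZMod 5) = 0 := (ZMod.natCast_eq_zero_iff 90 5).2 (by norm_num)
      push_cast at this ⊢
      linear_combination this

/-- all energies are 0 or 30 -/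
lemma S_vals {E A : Finset (Fin 3 → ZMod 5)} (hE : (E.card : ℤ) = (5 : ℕ) * ((5 : ℕ) - 2))
    (hA : (A.card : ℤ) = (5 : ℕ) * ((5 : ℕ) - 2))
    (h : ∀ x ∈ E, ∀ y ∈ E, x ≠ y → Eqd A (x - y))
    (h' : ∀ x ∈ A, ∀ y ∈ A, x ≠ y → Eqd E (x - y)) (ξ : Fin 3 → ZMod 5) :
    S E ξ = 0 ∨ S E ξ = 30 := by
  have hE15 : (E.card : ℤ) = 15 := by rw [hE]; norm_num
  have hpl : ∀ ξ : Fin 3 → ZMod 5, ξ ≠ 0 → ∀ t, pl E ξ t ≤ 5 :=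
    fun ξ hξ t => pl_le le_rfl hA h hξ t
  have hplA : ∀ ξ : Fin 3 → ZMod 5, ξ ≠ 0 → ∀ t, pl A ξ t ≤ 5 :=
    fun ξ hξ t => pl_le le_rfl hE h' hξ t
  have c1 := cauchy A
  have c2 := tau_sq_le A le_rfl hA hplA
  rw [sum_tau, hA] at c1
  norm_num at c1 c2
  have c3 : (66 : ℤ) ≤ (univ.filter (fun v => ¬ tau A v = 0)).card := by
    by_contra hlt
    have : ((univ.filter (fun v => ¬ tau A v = 0)).card : ℤ) * ∑ v, tau A v ^ 2 ≤ 65 * 10800 := by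
      apply mul_le_mul (by omega) c2
      · exact Finset.sum_nonneg fun v _ => sq_nonneg _
      · norm_num
    linarith
  have c4 : 66 ≤ (univ.filter (fun ξ => S E ξ = 0)).card := by
    have : (univ.filter (fun v => ¬ tau A v = 0)).card ≤ (univ.filter (fun ξ => S E ξ = 0)).card := by
      apply Finset.card_le_card
      intro v hv
      rw [mem_filter] at hv ⊢
      exact ⟨hv.1, S_tau hE h' hv.2⟩
    omega
  have m1 : ∀ ξ, mom E 1 ξ = 0 := by
    refine mom_zero E 1 ?_
    have : (univ.filter (fun ξ => S E ξ = 0)).card ≤ (univ.filter (fun ξ => mom E 1 ξ = 0)).card := by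
      apply Finset.card_le_card
      intro v hv
      rw [mem_filter] at hv ⊢
      exact ⟨hv.1, (mom_of_S hE hv.2).1⟩
    omega
  have m2 : ∀ ξ, mom E 2 ξ = 0 := by
    refine mom_zero E 2 ?_
    have : (univ.filter (fun ξ => S E ξ = 0)).card ≤ (univ.filter (fun ξ => mom E 2 ξ = 0)).card := by
      apply Finset.card_le_card
      intro v hv
      rw [mem_filter] at hv ⊢
      exact ⟨hv.1, (mom_of_S hE hv.2).2⟩
    omega
  have T : ∀ ξ, (S E ξ = 10 ∧ mom E 3 ξ ≠ 0) ∨ ((S E ξ = 0 ∨ S E ξ = 30) ∧ mom E 3 ξ = 0) := by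
    intro ξ
    by_cases hξ : ξ = 0
    · subst hξ
      right
      simp [S, mom]
    · exact trich hE15 hξ (hpl ξ hξ) (m1 ξ) (m2 ξ)
  have m3 : ∀ ξ, mom E 3 ξ = 0 := by
    refine mom_zero E 3 ?_
    have hF := F_eq E hE
    norm_num at hF
    have hpt : ∀ ξ, S E ξ ≤ 30 - 30 * (if S E ξ = 0 then 1 else 0)
        - 20 * (if ¬ mom E 3 ξ = 0 then 1 else 0) := by
      intro ξ
      rcases T ξ with ⟨h1, h2⟩ | ⟨h1 | h1, h2⟩ <;> simp [h1, h2]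
    have hsum := Finset.sum_le_sum (s := univ) fun ξ _ => hpt ξ
    rw [hF, Finset.sum_sub_distrib, Finset.sum_sub_distrib, ← Finset.mul_sum, ← Finset.mul_sum,
      Finset.sum_boole, Finset.sum_boole, Finset.sum_const, card_univ5] at hsum
    have hc := Finset.card_filter_add_card_filter_not (s := univ) (fun ξ => mom E 3 ξ = 0)
    rw [card_univ5] at hc
    norm_num at hsum
    omega
  rcases T ξ with ⟨_, h2⟩ | ⟨h1, _⟩
  · exact absurd (m3 ξ) h2
  · exact h1

lemma tau_vals {E : Finset (Fin 3 → ZMod 5)} (hE : (E.card : ℤ) = (5 : ℕ) * ((5 : ℕ) - 2))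
    (hpl : ∀ ξ : Fin 3 → ZMod 5, ξ ≠ 0 → ∀ t, pl E ξ t ≤ 5)
    (hS : ∀ ξ, S E ξ = 0 ∨ S E ξ = 30) (v : Fin 3 → ZMod 5) :
    tau E v = 0 ∨ tau E v = 6 ∨ tau E v = 12 ∨ tau E v = 30 := by
  have hE15 : (E.card : ℤ) = 15 := by rw [hE]; norm_num
  by_cases hv : v = 0
  · left; simp [tau, hv]
  have hB := B_eq E hE hv
  norm_num at hB
  by_cases hn : ∀ x ∈ E, nL E v x ≤ 2
  · have hR : R E v ≤ 30 := by
      unfold R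
      refine (Finset.sum_le_sum hn).trans ?_
      rw [Finset.sum_const, nsmul_eq_mul, hE15]
      norm_num
    have ht : tau E v ≤ 15 := by
      rw [tau, if_neg hv]
      linarith
    have h0 := tau_nonneg E v
    obtain ⟨k, hk⟩ := tau_even E v
    have hd : (30 : ℤ) ∣ B E v := by
      apply Finset.dvd_sum
      intro ξ _
      rcases hS ξ with h | h <;> simp [h]
    omega
  · push Not at hn
    obtain ⟨x, hx, hn⟩ := hn
    have h1 := sum_pl_perp E hv x
    have h0m : (0 : Fin 3 → ZMod 5) ∈ univ.filter (fun ξ => v ⬝ᵥ ξ = 0) := by simp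
    have hcard := card_perp1 hv
    rw [← Finset.add_sum_erase _ _ h0m] at h1
    have hpl0 : pl E 0 (x ⬝ᵥ 0) = E.card := by simp [pl]
    rw [hpl0, hE15] at h1
    have hcard2 : ((univ.filter (fun ξ => v ⬝ᵥ ξ = 0)).erase 0).card = 24 := by
      rw [Finset.card_erase_of_mem h0m, hcard]
      norm_num
    have h2 : ∀ ξ ∈ (univ.filter (fun ξ => v ⬝ᵥ ξ = 0)).erase 0, (pl E ξ (x ⬝ᵥ ξ) : ℤ) ≤ 5 := by
      intro ξ hξ
      exact_mod_cast hpl ξ (mem_erase.1 hξ).1 _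
    have h3 : ∀ ξ ∈ (univ.filter (fun ξ => v ⬝ᵥ ξ = 0)).erase 0, (pl E ξ (x ⬝ᵥ ξ) : ℤ) = 5 := by
      have hle := Finset.sum_le_sum h2
      refine (Finset.sum_eq_sum_iff_of_le h2).1 (le_antisymm hle ?_)
      rw [Finset.sum_const, hcard2]
      norm_num at h1 ⊢
      linarith
    have h4 : B E v = 720 := by
      rw [B, ← Finset.add_sum_erase _ _ h0m]
      have : ∀ ξ ∈ (univ.filter (fun ξ => v ⬝ᵥ ξ = 0)).erase 0, S E ξ = 30 := by
        intro ξ hξ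
        rcases hS ξ with h | h
        · have h5 := eqd_of_S hE (mem_erase.1 hξ).1 h (x ⬝ᵥ ξ)
          rw [h3 ξ hξ] at h5
          norm_num at h5
        · exact h
      rw [Finset.sum_congr rfl this, Finset.sum_const, hcard2]
      simp [S]
    omega

lemma small_p {E A : Finset (Fin 3 → ZMod 5)} (hE : (E.card : ℤ) = (5 : ℕ) * ((5 : ℕ) - 2))
    (hA : (A.card : ℤ) = (5 : ℕ) * ((5 : ℕ) - 2))
    (h : ∀ x ∈ E, ∀ y ∈ E, x ≠ y → Eqd A (x - y))
    (h' : ∀ x ∈ A, ∀ y ∈ A, x ≠ y → Eqd E (x - y)) : False := by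
  have hpl : ∀ ξ : Fin 3 → ZMod 5, ξ ≠ 0 → ∀ t, pl E ξ t ≤ 5 :=
    fun ξ hξ t => pl_le le_rfl hA h hξ t
  have hS := S_vals hE hA h h'
  have hT := tau_vals hE hpl hS
  have hF := F_eq E hE
  have hst := sum_tau E
  have hsq := tau_sq E hE
  have hD := D_le le_rfl hA (fun ξ hξ t => pl_le le_rfl hE h' hξ t) h
  have hS2 : ∑ ξ, S E ξ ^ 2 = 30 * ∑ ξ, S E ξ := by
    rw [Finset.mul_sum]
    refine Finset.sum_congr rfl fun ξ _ => ?_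
    rcases hS ξ with h | h <;> rw [h] <;> norm_num
  rw [hE] at hst
  rw [hS2, hF, hst] at hsq
  norm_num at hst hsq hD
  have hsq' : ∑ v, tau E v ^ 2 = 10800 := by linarith
  have hpt : ∀ v, tau E v ^ 2 = 18 * tau E v - 72 * (if ¬ tau E v = 0 then 1 else 0)
      + 432 * (if tau E v = 30 then 1 else 0) := by
    intro v
    rcases hT v with h | h | h | h <;> rw [h] <;> norm_num
  have hsum := Finset.sum_congr (s₁ := (univ : Finset (Fin 3 → ZMod 5))) rfl fun v _ => hpt v
  rw [hsq', Finset.sum_add_distrib, Finset.sum_sub_distrib, ← Finset.mul_sum, ← Finset.mul_sum,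
      ← Finset.mul_sum, Finset.sum_boole, Finset.sum_boole, hst] at hsum
  by_cases hJ : ∃ v, tau E v = 30
  · obtain ⟨v, hv⟩ := hJ
    have hv0 : v ≠ 0 := by
      rintro rfl
      simp [tau] at hv
    have h4 : 4 ≤ (univ.filter (fun v => tau E v = 30)).card := by
      have hc : ((univ.erase (0 : ZMod 5)).image (fun c => c • v)).card = 4 := by
        rw [Finset.card_image_of_injective _ (smul_left_injective _ hv0)]
        rw [Finset.card_erase_of_mem (mem_univ _), Finset.card_univ, ZMod.card]
      refine hc.symm.le.trans (Finset.card_le_card ?_)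
      intro w hw
      rw [mem_image] at hw
      obtain ⟨c, hc, rfl⟩ := hw
      rw [mem_filter]
      exact ⟨mem_univ _, by rw [tau_smul E v (mem_erase.1 hc).1, hv]⟩
    omega
  · push Not at hJ
    have hle : ∀ v, tau E v ≤ 12 * (if ¬ tau E v = 0 then 1 else 0) := by
      intro v
      have := hJ v
      rcases hT v with h | h | h | h <;> rw [h] <;> norm_num
      exact this h
    have hs := Finset.sum_le_sum (s := univ) fun v _ => hle v
    rw [hst, ← Finset.mul_sum, Finset.sum_boole] at hs
    have hz : (univ.filter (fun v => tau E v = 30)).card = 0 := by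
      rw [Finset.card_eq_zero, Finset.filter_eq_empty_iff]
      exact fun v _ => hJ v
    omega

end finale

end Spec

/-- For a prime `p ≥ 5`, no subset of `𝔽_p^3` of size `p(p - 2)` is spectral. -/
theorem no_spectral_of_card_p_mul_p_sub_two (p : ℕ) (hp : p.Prime) (h5 : 5 ≤ p)
    (E : Finset (Fin 3 → ZMod p)) (hE : E.card = p * (p - 2)) :
    ¬ IsSpectral p E := by
  haveI : Fact p.Prime := ⟨hp⟩
  rintro ⟨A, hA⟩
  have hcard := Spec.card_eq hA
  obtain ⟨h1, h2⟩ := Spec.spectral_eqd hA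
  have hE2 : (E.card : ℤ) = p * (p - 2) := by
    rw [hE]
    push_cast [show 2 ≤ p by omega]
    ring
  have hA2 : (A.card : ℤ) = p * (p - 2) := by rw [hcard, hE2]
  rcases h5.eq_or_lt with h | h
  · subst h
    exact Spec.small_p hE2 hA2 (by assumption) (by assumption)
  · rcases (Nat.succ_le_of_lt h).eq_or_lt with h6 | h6
    · rw [← h6] at hp
      exact absurd hp (by norm_num)
    · exact Spec.large_p h6 hE2 hA2 (by assumption) (by assumption)
end

section
/- Suppose E ⊆ 𝔽_7^2 has exactly five points, no three of which are collinear (no line of 𝔽_7^2 contains three points of E). Then E determines at least six directions; that is, the number of one-dimensional subspaces d of 𝔽_7^2 for which there exist distinct e₁, e₂ ∈ E with e₁ − e₂ ∈ d is at least 6. -/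
open Finset

/-- Cross product of two plane vectors. -/
def crossProd7 (a b : ZMod 7 × ZMod 7) : ZMod 7 := a.1 * b.2 - a.2 * b.1

/-- Canonical representative of the direction of a nonzero vector. -/
def canonDir7 (a : ZMod 7 × ZMod 7) : ZMod 7 × ZMod 7 :=
  if a.1 = 0 then (0, 1) else (1, a.2 * a.1 ^ 5)

/-- The normalized five points. -/
def normPts7 (x y z w : ZMod 7) : Fin 5 → ZMod 7 × ZMod 7 :=
  ![(0, 0), (1, 0), (0, 1), (x, y), (z, w)]

/-- The directions of a list of five points. -/
def dirs7 (g : Fin 5 → ZMod 7 × ZMod 7) : Finset (ZMod 7 × ZMod 7) :=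
  {canonDir7 (g 1 - g 0), canonDir7 (g 2 - g 0), canonDir7 (g 3 - g 0), canonDir7 (g 4 - g 0),
    canonDir7 (g 2 - g 1), canonDir7 (g 3 - g 1), canonDir7 (g 4 - g 1),
    canonDir7 (g 3 - g 2), canonDir7 (g 4 - g 2), canonDir7 (g 4 - g 3)}

/-- Numerical code of the direction of the vector `(s, t)`, computed on natural numbers. -/
def natCode7 (s t : ℕ) : ℕ := bif s % 7 == 0 then 7 else t * s ^ 5 % 7

/-- Numerical code of a canonical direction. -/
def dirCode7 (c : ZMod 7 × ZMod 7) : ℕ := if c.1 = 0 then 7 else c.2.val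

theorem dirCode7_canonDir7 (s t : ℕ) :
    dirCode7 (canonDir7 ((s : ZMod 7), (t : ZMod 7))) = natCode7 s t := by
  have : Fact (Nat.Prime 7) := ⟨by norm_num⟩
  have h1 : ((s : ZMod 7) = 0) ↔ s % 7 = 0 := by
    rw [ZMod.natCast_eq_zero_iff, Nat.dvd_iff_mod_eq_zero]
  by_cases h : s % 7 = 0
  · simp [dirCode7, canonDir7, natCode7, h1, h]
  · have h2 : ((t : ZMod 7) * (s : ZMod 7) ^ 5) = ((t * s ^ 5 : ℕ) : ZMod 7) := by push_cast; rfl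
    have h3 : canonDir7 ((s : ZMod 7), (t : ZMod 7)) = (1, ((t * s ^ 5 : ℕ) : ZMod 7)) := by
      rw [← h2]
      exact if_neg (fun hs => h (h1.1 hs))
    have h4 : natCode7 s t = t * s ^ 5 % 7 := by
      rw [natCode7, beq_eq_false_iff_ne.2 h, cond_false]
    rw [h3, h4, ← ZMod.val_natCast]
    exact if_neg (one_ne_zero (α := ZMod 7))

/-- Codes of the ten directions of the normalized five points (note `6 = -1` modulo `7`). -/
def natCodes7 (a b c d : ℕ) : List ℕ :=
  [natCode7 1 0, natCode7 0 1, natCode7 a b, natCode7 c d,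
    natCode7 6 1, natCode7 (a + 6) b, natCode7 (c + 6) d,
    natCode7 a (b + 6), natCode7 c (d + 6), natCode7 (c + 6 * a) (d + 6 * b)]

/-- Some three of the normalized points are collinear. -/
def natBad7 (a b c d : ℕ) : Bool :=
  a % 7 == 0 || b % 7 == 0 || c % 7 == 0 || d % 7 == 0 || (a + b) % 7 == 1 || (c + d) % 7 == 1 ||
    a * d % 7 == b * c % 7 || (a + 6) * d % 7 == b * (c + 6) % 7 ||
    a * (d + 6) % 7 == (b + 6) * c % 7

theorem nat_check7 : ∀ a < 7, ∀ b < 7, ∀ c < 7, ∀ d < 7,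
    (natBad7 a b c d || Nat.ble 6
      ((List.range 8).countP fun m => (natCodes7 a b c d).any (Nat.beq m))) = true := by
  decide +kernel

theorem normalized_check7 (x y z w : ZMod 7)
    (h : ∀ i j k : Fin 5, i < j → j < k → crossProd7 (normPts7 x y z w j - normPts7 x y z w i)
      (normPts7 x y z w k - normPts7 x y z w i) ≠ 0) :
    6 ≤ (dirs7 (normPts7 x y z w)).card := by
  obtain ⟨a, ha, rfl⟩ : ∃ a < 7, ((a : ℕ) : ZMod 7) = x := ⟨x.val, x.val_lt, by simp⟩
  obtain ⟨b, hb, rfl⟩ : ∃ a < 7, ((a : ℕ) : ZMod 7) = y := ⟨y.val, y.val_lt, by simp⟩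
  obtain ⟨c, hc, rfl⟩ : ∃ a < 7, ((a : ℕ) : ZMod 7) = z := ⟨z.val, z.val_lt, by simp⟩
  obtain ⟨d, hd, rfl⟩ : ∃ a < 7, ((a : ℕ) : ZMod 7) = w := ⟨w.val, w.val_lt, by simp⟩
  have h6 : (6 : ZMod 7) = -1 := by decide
  have hm : ∀ m n : ℕ, m % 7 = n % 7 → (m : ZMod 7) = n := fun m n hmn =>
    (ZMod.natCast_eq_natCast_iff' m n 7).2 hmn
  have hbad : natBad7 a b c d = false := by
    rw [Bool.eq_false_iff]
    intro hB
    simp only [natBad7, Bool.or_eq_true, beq_iff_eq] at hB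
    rcases hB with (((((((hB | hB) | hB) | hB) | hB) | hB) | hB) | hB) | hB
    · have e := hm a 0 hB
      refine h 0 2 3 (by decide) (by decide) ?_
      simp [crossProd7, normPts7]; simpa using e
    · have e := hm b 0 hB
      refine h 0 1 3 (by decide) (by decide) ?_
      simp [crossProd7, normPts7]; simpa using e
    · have e := hm c 0 hB
      refine h 0 2 4 (by decide) (by decide) ?_
      simp [crossProd7, normPts7]; simpa using e
    · have e := hm d 0 hB
      refine h 0 1 4 (by decide) (by decide) ?_
      simp [crossProd7, normPts7]; simpa using e
    · have e := hm (a + b) 1 hB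
      refine h 1 2 3 (by decide) (by decide) ?_
      push_cast at e
      simp [crossProd7, normPts7]; linear_combination -e
    · have e := hm (c + d) 1 hB
      refine h 1 2 4 (by decide) (by decide) ?_
      push_cast at e
      simp [crossProd7, normPts7]; linear_combination -e
    · have e := hm _ _ hB
      refine h 0 3 4 (by decide) (by decide) ?_
      push_cast at e
      simp [crossProd7, normPts7]; linear_combination e
    · have e := hm _ _ hB
      refine h 1 3 4 (by decide) (by decide) ?_
      push_cast [h6] at e
      simp [crossProd7, normPts7]; linear_combination e
    · have e := hm _ _ hB
      refine h 2 3 4 (by decide) (by decide) ?_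
      push_cast [h6] at e
      simp [crossProd7, normPts7]; linear_combination e
  have hk := nat_check7 a ha b hb c hc d hd
  rw [hbad, Bool.false_or, Nat.ble_eq] at hk
  refine hk.trans ?_
  rw [List.countP_eq_length_filter]
  rw [← List.toFinset_card_of_nodup (List.nodup_range.filter _)]
  refine le_trans (Finset.card_le_card ?_) (Finset.card_image_le (f := dirCode7))
  intro m hmm
  simp only [List.mem_toFinset, List.mem_filter, List.any_eq_true, Nat.beq_eq] at hmm
  obtain ⟨-, n, hn, rfl⟩ := hmm
  rw [Finset.mem_image]
  have key : ∀ s t : ℕ, ∀ v : ZMod 7 × ZMod 7, v = ((s : ZMod 7), (t : ZMod 7)) →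
      m = natCode7 s t → dirCode7 (canonDir7 v) = m := by
    rintro s t v rfl rfl
    exact dirCode7_canonDir7 s t
  simp only [natCodes7, List.mem_cons, List.not_mem_nil, or_false] at hn
  rcases hn with hn | hn | hn | hn | hn | hn | hn | hn | hn | hn
  · exact ⟨_, by simp [dirs7], key _ _ (normPts7 a b c d 1 - normPts7 a b c d 0)
      (by simp [normPts7]) hn⟩
  · exact ⟨_, by simp [dirs7], key _ _ (normPts7 a b c d 2 - normPts7 a b c d 0)
      (by ext <;> simp [normPts7, h6] <;> try ring) hn⟩
  · exact ⟨_, by simp [dirs7], key _ _ (normPts7 a b c d 3 - normPts7 a b c d 0)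
      (by ext <;> simp [normPts7, h6] <;> try ring) hn⟩
  · exact ⟨_, by simp [dirs7], key _ _ (normPts7 a b c d 4 - normPts7 a b c d 0)
      (by ext <;> simp [normPts7, h6] <;> try ring) hn⟩
  · exact ⟨_, by simp [dirs7], key _ _ (normPts7 a b c d 2 - normPts7 a b c d 1)
      (by ext <;> simp [normPts7, h6] <;> try ring) hn⟩
  · exact ⟨_, by simp [dirs7], key _ _ (normPts7 a b c d 3 - normPts7 a b c d 1)
      (by ext <;> simp [normPts7, h6] <;> try ring) hn⟩
  · exact ⟨_, by simp [dirs7], key _ _ (normPts7 a b c d 4 - normPts7 a b c d 1)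
      (by ext <;> simp [normPts7, h6] <;> try ring) hn⟩
  · exact ⟨_, by simp [dirs7], key _ _ (normPts7 a b c d 3 - normPts7 a b c d 2)
      (by ext <;> simp [normPts7, h6] <;> try ring) hn⟩
  · exact ⟨_, by simp [dirs7], key _ _ (normPts7 a b c d 4 - normPts7 a b c d 2)
      (by ext <;> simp [normPts7, h6] <;> try ring) hn⟩
  · exact ⟨_, by simp [dirs7], key _ _ (normPts7 a b c d 4 - normPts7 a b c d 3)
      (by ext <;> simp [normPts7, h6] <;> try ring) hn⟩

theorem canonDir7_mul : ∀ a : ZMod 7 × ZMod 7, a ≠ 0 → ∃ k : ZMod 7, k • a = canonDir7 a := by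
  decide +kernel

theorem canonDir7_inj (a b : ZMod 7 × ZMod 7) (k : ZMod 7)
    (h : k • canonDir7 a = canonDir7 b) : canonDir7 a = canonDir7 b := by
  unfold canonDir7 at *
  have h01 : (0 : ZMod 7) ≠ 1 := by decide
  split_ifs at * <;> simp only [Prod.smul_mk, smul_eq_mul, mul_zero, mul_one, Prod.mk.injEq] at h
  · rfl
  · exact absurd h.1 h01
  · rw [h.1, zero_mul] at h
    exact absurd h.2 h01
  · rw [h.1, one_mul] at h
    rw [h.2]

theorem canonDir7_ne_zero : ∀ a : ZMod 7 × ZMod 7, canonDir7 a ≠ 0 := by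
  decide +kernel

theorem crossProd7_eq_zero (a b : ZMod 7 × ZMod 7) (ha : a ≠ 0) (h : crossProd7 a b = 0) :
    ∃ k : ZMod 7, k • a = b := by
  have : Fact (Nat.Prime 7) := ⟨by norm_num⟩
  obtain ⟨a1, a2⟩ := a
  obtain ⟨b1, b2⟩ := b
  simp only [crossProd7] at h
  by_cases h1 : a1 = 0
  · have h2 : a2 ≠ 0 := by
      rintro rfl
      exact ha (by simp [h1])
    subst h1
    have h3 : b1 = 0 := by simpa [h2] using h
    refine ⟨b2 / a2, ?_⟩
    ext
    · simp [h3]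
    · simp [h2]
  · refine ⟨b1 / a1, ?_⟩
    ext
    · simp [h1]
    · simp only [Prod.smul_mk, smul_eq_mul]
      field_simp
      linear_combination -h

theorem dirs7_mem (g : Fin 5 → ZMod 7 × ZMod 7) (c : ZMod 7 × ZMod 7) (hc : c ∈ dirs7 g) :
    ∃ i j, i ≠ j ∧ c = canonDir7 (g i - g j) := by
  simp only [dirs7, Finset.mem_insert, Finset.mem_singleton] at hc
  rcases hc with h | h | h | h | h | h | h | h | h | h
  exacts [⟨1, 0, by decide, h⟩, ⟨2, 0, by decide, h⟩, ⟨3, 0, by decide, h⟩, ⟨4, 0, by decide, h⟩,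
    ⟨2, 1, by decide, h⟩, ⟨3, 1, by decide, h⟩, ⟨4, 1, by decide, h⟩,
    ⟨3, 2, by decide, h⟩, ⟨4, 2, by decide, h⟩, ⟨4, 3, by decide, h⟩]

/-- A five-point subset of `𝔽_7^2` with no three collinear points determines at
least six directions. -/
theorem five_points_determine_six_directions (E : Finset (Fin 2 → ZMod 7))
    (hcard : E.card = 5)
    (hcol : ∀ (v : Fin 2 → ZMod 7) (D : Submodule (ZMod 7) (Fin 2 → ZMod 7)),
      Module.finrank (ZMod 7) D = 1 →
      ((E : Set (Fin 2 → ZMod 7)) ∩ {y | y - v ∈ D}).ncard ≤ 2) :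
    6 ≤ {D : Submodule (ZMod 7) (Fin 2 → ZMod 7) |
      Module.finrank (ZMod 7) D = 1 ∧ Determines 7 E D}.ncard := by
  classical
  have : Fact (Nat.Prime 7) := ⟨by norm_num⟩
  -- no three points on a line, in coordinates
  have hnc : ∀ p ∈ E, ∀ q ∈ E, ∀ r ∈ E, p ≠ q → p ≠ r → q ≠ r → ∀ k : ZMod 7,
      k • (q - p) ≠ r - p := by
    intro p hp q hq r hr hpq hpr hqr k hk
    have h1 := hcol p (Submodule.span (ZMod 7) {q - p})
      (finrank_span_singleton (sub_ne_zero.2 hpq.symm))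
    have h2 : ((({p, q, r} : Finset (Fin 2 → ZMod 7)) : Set (Fin 2 → ZMod 7))) ⊆
        (E : Set (Fin 2 → ZMod 7)) ∩ {y | y - p ∈ Submodule.span (ZMod 7) {q - p}} := by
      intro y hy
      simp only [Finset.coe_insert, Finset.coe_singleton, Set.mem_insert_iff,
        Set.mem_singleton_iff] at hy
      rcases hy with rfl | rfl | rfl
      · exact ⟨hp, by simp⟩
      · exact ⟨hq, Submodule.mem_span_singleton_self _⟩
      · exact ⟨hr, Submodule.mem_span_singleton.2 ⟨k, hk⟩⟩
    have h3 := Set.ncard_le_ncard h2 (Set.toFinite _)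
    rw [Set.ncard_coe_finset, Finset.card_eq_three.2 ⟨p, q, r, hpq, hpr, hqr, rfl⟩] at h3
    omega
  -- enumerate the points
  let en := (E.equivFinOfCardEq hcard).symm
  let e : Fin 5 → (Fin 2 → ZMod 7) := fun i => (en i).1
  have heE : ∀ i, e i ∈ E := fun i => (en i).2
  have hinj : ∀ i j, i ≠ j → e i ≠ e j := fun i j hij h =>
    hij (en.injective (Subtype.ext h))
  -- linear coordinates
  let φ : (ZMod 7 × ZMod 7) →ₗ[ZMod 7] (Fin 2 → ZMod 7) :=
    (LinearMap.toSpanSingleton (ZMod 7) _ (e 1 - e 0)).coprod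
      (LinearMap.toSpanSingleton (ZMod 7) _ (e 2 - e 0))
  have hφ : ∀ c, φ c = c.1 • (e 1 - e 0) + c.2 • (e 2 - e 0) := fun c => by simp [φ]
  have hφi : Function.Injective φ := by
    rw [injective_iff_map_eq_zero]
    rintro ⟨s, t⟩ h
    rw [hφ] at h
    simp only at h
    have hu : e 1 - e 0 ≠ 0 := sub_ne_zero.2 (hinj _ _ (by decide))
    by_cases ht : t = 0
    · subst ht
      simp only [zero_smul, add_zero] at h
      rcases smul_eq_zero.1 h with h | h
      · simp [h]
      · exact absurd h hu
    · exfalso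
      refine hnc (e 0) (heE _) (e 1) (heE _) (e 2) (heE _) (hinj _ _ (by decide))
        (hinj _ _ (by decide)) (hinj _ _ (by decide)) (-(t⁻¹ * s)) ?_
      have h4 : t • (e 2 - e 0) = -(s • (e 1 - e 0)) := by
        rw [eq_neg_iff_add_eq_zero, add_comm]; exact h
      rw [neg_smul, mul_smul, ← smul_neg, ← h4, smul_smul, inv_mul_cancel₀ ht, one_smul]
  have hφs : Function.Surjective φ :=
    ((Fintype.bijective_iff_injective_and_card φ).2 ⟨hφi, by simp [ZMod.card]⟩).2
  obtain ⟨⟨x, y⟩, h3⟩ := hφs (e 3 - e 0)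
  obtain ⟨⟨z, w⟩, h4⟩ := hφs (e 4 - e 0)
  set g := normPts7 x y z w with hg
  have hgφ : ∀ i, φ (g i) = e i - e 0 := by
    intro i
    fin_cases i
    · simp [hg, normPts7, hφ]
    · simp [hg, normPts7, hφ]
    · simp [hg, normPts7, hφ]
    · exact h3
    · exact h4
  have hgs : ∀ i j, φ (g i - g j) = e i - e j := by
    intro i j
    rw [map_sub, hgφ, hgφ]; abel
  have hg0 : ∀ i j, i ≠ j → g i - g j ≠ 0 := by
    intro i j hij h
    have := hgs i j
    rw [h, map_zero] at this
    exact hinj i j hij (sub_eq_zero.1 this.symm)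
  have hcnt : 6 ≤ (dirs7 g).card := by
    apply normalized_check7
    intro i j k hij hjk h
    obtain ⟨m, hm⟩ := crossProd7_eq_zero _ _ (hg0 j i hij.ne') h
    refine hnc (e i) (heE _) (e j) (heE _) (e k) (heE _) (hinj _ _ hij.ne)
      (hinj _ _ (hij.trans hjk).ne) (hinj _ _ hjk.ne) m ?_
    rw [← hgs, ← hgs, ← map_smul]
    exact congrArg φ hm
  let F : ZMod 7 × ZMod 7 → Submodule (ZMod 7) (Fin 2 → ZMod 7) :=
    fun c => Submodule.span (ZMod 7) {φ c}
  have hFi : Set.InjOn F (dirs7 g : Set (ZMod 7 × ZMod 7)) := by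
    intro c hc d hd hcd
    obtain ⟨i, j, -, rfl⟩ := dirs7_mem g c hc
    obtain ⟨i', j', -, rfl⟩ := dirs7_mem g d hd
    have h5 : φ (canonDir7 (g i' - g j')) ∈ F (canonDir7 (g i - g j)) := by
      rw [hcd]; exact Submodule.mem_span_singleton_self _
    obtain ⟨m, hm⟩ := Submodule.mem_span_singleton.1 h5
    rw [← map_smul] at hm
    exact canonDir7_inj _ _ m (hφi hm)
  have hsub : (((dirs7 g).image F : Finset _) : Set (Submodule (ZMod 7) (Fin 2 → ZMod 7))) ⊆
      {D | Module.finrank (ZMod 7) D = 1 ∧ Determines 7 E D} := by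
    intro D hD
    simp only [Finset.coe_image, Set.mem_image, Finset.mem_coe] at hD
    obtain ⟨c, hc, rfl⟩ := hD
    obtain ⟨i, j, hij, rfl⟩ := dirs7_mem g c hc
    refine ⟨finrank_span_singleton ?_, e i, heE i, e j, heE j, hinj i j hij, ?_⟩
    · intro h
      exact canonDir7_ne_zero (g i - g j) (hφi (h.trans (map_zero φ).symm))
    · obtain ⟨k, hk⟩ := canonDir7_mul _ (hg0 i j hij)
      have hk0 : k ≠ 0 := by
        rintro rfl
        exact canonDir7_ne_zero (g i - g j) (by rw [← hk, zero_smul])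
      refine Submodule.mem_span_singleton.2 ⟨k⁻¹, ?_⟩
      rw [← hk, map_smul, hgs, smul_smul, inv_mul_cancel₀ hk0, one_smul]
  have h6 := Set.ncard_le_ncard hsub (Set.toFinite _)
  rw [Set.ncard_coe_finset, Finset.card_image_of_injOn hFi] at h6
  exact hcnt.trans h6
end

section
/- Suppose E ⊆ 𝔽_7^2 has exactly seven points, no four of which are collinear (no line of 𝔽_7^2 contains four points of E). Then E determines at least six directions; that is, the number of one-dimensional subspaces d of 𝔽_7^2 for which there exist distinct e₁, e₂ ∈ E with e₁ − e₂ ∈ d is at least 6. -/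
open Finset

/-- The function on `ZMod 7` with the given table of values. -/
def table7 (a1 a2 a3 a4 a5 a6 : ZMod 7) : ZMod 7 → ZMod 7 :=
  fun t => (![0, a1, a2, a3, a4, a5, a6] : Fin 7 → ZMod 7) t

set_option synthInstance.maxSize 5000 in
set_option synthInstance.maxHeartbeats 1000000 in
set_option maxRecDepth 10000 in
/-- The enumeration of normalized orthomorphisms of `ZMod 7`. -/
lemma orth_enum :
    ∀ a1 : ZMod 7, a1 ≠ 0 → a1 ≠ 1 →
    ∀ a2 : ZMod 7, a2 ≠ 0 → a2 ≠ 2 → a2 ≠ a1 → a2 ≠ a1 + 1 →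
    ∀ a3 : ZMod 7, a3 ≠ 0 → a3 ≠ 3 → a3 ≠ a1 → a3 ≠ a1 + 2 → a3 ≠ a2 → a3 ≠ a2 + 1 →
    ∀ a4 : ZMod 7, a4 ≠ 0 → a4 ≠ 4 → a4 ≠ a1 → a4 ≠ a1 + 3 → a4 ≠ a2 → a4 ≠ a2 + 2 → a4 ≠ a3 → a4 ≠ a3 + 1 →
    ∀ a5 : ZMod 7, a5 ≠ 0 → a5 ≠ 5 → a5 ≠ a1 → a5 ≠ a1 + 4 → a5 ≠ a2 → a5 ≠ a2 + 3 → a5 ≠ a3 → a5 ≠ a3 + 2 → a5 ≠ a4 → a5 ≠ a4 + 1 →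
    ∀ a6 : ZMod 7, a6 ≠ 0 → a6 ≠ 6 → a6 ≠ a1 → a6 ≠ a1 + 5 → a6 ≠ a2 → a6 ≠ a2 + 4 → a6 ≠ a3 → a6 ≠ a3 + 3 → a6 ≠ a4 → a6 ≠ a4 + 2 → a6 ≠ a5 → a6 ≠ a5 + 1 →
    ∃ m b : ZMod 7, 4 ≤ ((univ : Finset (ZMod 7)).filter
      (fun t : ZMod 7 => table7 a1 a2 a3 a4 a5 a6 t = m * t + b)).card := by
  decide +kernel

lemma orth_collinear (f : ZMod 7 → ZMod 7) (h1 : Function.Injective f)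
    (h2 : Function.Injective (fun t => f t - t)) :
    ∃ m b : ZMod 7, 4 ≤ ((univ : Finset (ZMod 7)).filter (fun t => f t = m * t + b)).card := by
  set g : ZMod 7 → ZMod 7 := fun t => f t - f 0 with hg
  have n1 : ∀ i j : ZMod 7, i ≠ j → g i ≠ g j := by
    intro i j hij h
    exact hij (h1 (by simpa [hg] using h))
  have n2 : ∀ i j k : ZMod 7, i ≠ j → i - j = k → g i ≠ g j + k := by
    intro i j k hij hk h
    refine hij (h2 ?_)
    simp only [hg] at h
    simp only
    rw [← hk] at h
    linear_combination h
  have g0 : g 0 = 0 := by simp [hg]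
  have z1 : ∀ i : ZMod 7, i ≠ 0 → g i ≠ 0 := fun i hi => by simpa [g0] using n1 i 0 hi
  have z2 : ∀ i : ZMod 7, i ≠ 0 → g i ≠ i := fun i hi => by
    simpa [g0] using n2 i 0 i hi (by simp)
  obtain ⟨m, b, h⟩ := orth_enum
    (g 1) (z1 1 (by decide)) (z2 1 (by decide))
    (g 2) (z1 2 (by decide)) (z2 2 (by decide)) (n1 2 1 (by decide)) (n2 2 1 1 (by decide) (by decide))
    (g 3) (z1 3 (by decide)) (z2 3 (by decide)) (n1 3 1 (by decide)) (n2 3 1 2 (by decide) (by decide)) (n1 3 2 (by decide)) (n2 3 2 1 (by decide) (by decide))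
    (g 4) (z1 4 (by decide)) (z2 4 (by decide)) (n1 4 1 (by decide)) (n2 4 1 3 (by decide) (by decide)) (n1 4 2 (by decide)) (n2 4 2 2 (by decide) (by decide)) (n1 4 3 (by decide)) (n2 4 3 1 (by decide) (by decide))
    (g 5) (z1 5 (by decide)) (z2 5 (by decide)) (n1 5 1 (by decide)) (n2 5 1 4 (by decide) (by decide)) (n1 5 2 (by decide)) (n2 5 2 3 (by decide) (by decide)) (n1 5 3 (by decide)) (n2 5 3 2 (by decide) (by decide)) (n1 5 4 (by decide)) (n2 5 4 1 (by decide) (by decide))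
    (g 6) (z1 6 (by decide)) (z2 6 (by decide)) (n1 6 1 (by decide)) (n2 6 1 5 (by decide) (by decide)) (n1 6 2 (by decide)) (n2 6 2 4 (by decide) (by decide)) (n1 6 3 (by decide)) (n2 6 3 3 (by decide) (by decide)) (n1 6 4 (by decide)) (n2 6 4 2 (by decide) (by decide)) (n1 6 5 (by decide)) (n2 6 5 1 (by decide) (by decide))
  refine ⟨m, b + f 0, h.trans (card_le_card ?_)⟩
  have hv : ∀ t : ZMod 7,
      table7 (g 1) (g 2) (g 3) (g 4) (g 5) (g 6) t = g t := by
    intro t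
    change Fin 7 at t
    fin_cases t
    · exact g0.symm
    all_goals rfl
  intro t ht
  simp only [mem_filter, mem_univ, true_and, hv] at ht ⊢
  simp only [hg] at ht
  linear_combination ht

/-- Eight direction vectors. -/
def dirVec (o : Option (ZMod 7)) : Fin 2 → ZMod 7 :=
  match o with
  | none => ![0, 1]
  | some m => ![1, m]

lemma fact7 : Fact (Nat.Prime 7) := ⟨by norm_num⟩

lemma dirVec_ne (o : Option (ZMod 7)) : dirVec o ≠ 0 := by
  have := fact7
  intro h
  cases o with
  | none => simpa [dirVec] using congrFun h 1
  | some m => simpa [dirVec] using congrFun h 0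

lemma dirVec_inj : Function.Injective
    (fun o => Submodule.span (ZMod 7) {dirVec o}) := by
  have := fact7
  intro o o' h
  have hm : dirVec o ∈ Submodule.span (ZMod 7) {dirVec o'} := by
    rw [← show Submodule.span (ZMod 7) {dirVec o} = Submodule.span (ZMod 7) {dirVec o'} from h]
    exact Submodule.mem_span_singleton_self _
  obtain ⟨c, hc⟩ := Submodule.mem_span_singleton.1 hm
  have h0 := congrFun hc 0
  have h1 := congrFun hc 1
  cases o <;> cases o' <;> simp [dirVec] at h0 h1 ⊢
  · simp [h0] at h1
  · simp [h0] at h1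
    exact h1.symm

/-- A seven-point subset of `𝔽_7^2` with no four collinear points determines at
least six directions. -/
theorem seven_points_determine_six_directions (E : Finset (Fin 2 → ZMod 7))
    (hcard : E.card = 7)
    (hcol : ∀ (v : Fin 2 → ZMod 7) (D : Submodule (ZMod 7) (Fin 2 → ZMod 7)),
      Module.finrank (ZMod 7) D = 1 →
      ((E : Set (Fin 2 → ZMod 7)) ∩ {y | y - v ∈ D}).ncard ≤ 3) :
    6 ≤ {D : Submodule (ZMod 7) (Fin 2 → ZMod 7) |
      Module.finrank (ZMod 7) D = 1 ∧ Determines 7 E D}.ncard := by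
  classical
  have := fact7
  by_contra hlt
  push Not at hlt
  set S := {D : Submodule (ZMod 7) (Fin 2 → ZMod 7) |
      Module.finrank (ZMod 7) D = 1 ∧ Determines 7 E D} with hS
  have hSf : S.Finite := Set.toFinite S
  -- three undetermined directions
  have hT : 2 < ((univ : Finset (Option (ZMod 7))).filter
      (fun o => Submodule.span (ZMod 7) {dirVec o} ∉ S)).card := by
    have h8 : (univ : Finset (Option (ZMod 7))).card = 8 := by
      rw [Finset.card_univ, Fintype.card_option, ZMod.card]
    have hsum := Finset.card_filter_add_card_filter_not (s := (univ : Finset (Option (ZMod 7))))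
      (fun o => Submodule.span (ZMod 7) {dirVec o} ∈ S)
    have hle : ((univ : Finset (Option (ZMod 7))).filter
        (fun o => Submodule.span (ZMod 7) {dirVec o} ∈ S)).card ≤ S.ncard := by
      rw [← Finset.card_image_of_injective _ dirVec_inj, ← Set.ncard_coe_finset]
      refine Set.ncard_le_ncard ?_ hSf
      intro D hD
      simp only [coe_image, coe_filter, mem_univ, true_and, Set.mem_image, Set.mem_ofPred_eq] at hD
      obtain ⟨o, ho, rfl⟩ := hD
      exact ho
    omega
  obtain ⟨o1, o2, o3, ho1, ho2, ho3, h12, h13, h23⟩ := Finset.two_lt_card_iff.1 hT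
  have key : ∀ o, o ∈ ((univ : Finset (Option (ZMod 7))).filter
      (fun o => Submodule.span (ZMod 7) {dirVec o} ∉ S)) →
      ∀ e ∈ E, ∀ e' ∈ E, ∀ c : ZMod 7, e - e' = c • dirVec o → e = e' := by
    intro o ho e he e' he' c hc
    by_contra hne
    refine (mem_filter.1 ho).2 ⟨finrank_span_singleton (dirVec_ne o), e, he, e', he', hne, ?_⟩
    rw [hc]
    exact Submodule.smul_mem _ _ (Submodule.mem_span_singleton_self _)
  have hli : ∀ o o', o ≠ o' → dirVec o 0 * dirVec o' 1 - dirVec o 1 * dirVec o' 0 ≠ 0 := by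
    intro o o' hne h
    apply hne
    cases o <;> cases o' <;> simp [dirVec] at h ⊢
    linear_combination -h
  have k1 := key o1 ho1
  have k2 := key o2 ho2
  have k3 := key o3 ho3
  have d12 := hli o1 o2 h12
  have d13 := hli o1 o3 h13
  have d32 := hli o3 o2 h23.symm
  generalize dirVec o1 = u at *
  generalize dirVec o2 = v at *
  generalize dirVec o3 = w at *
  -- coordinates: `e = X e • a + Y e • b` with `a`, `b` multiples of `u`, `v` and `a + b ∥ w`
  set δ := u 0 * v 1 - u 1 * v 0 with hδ
  set α := w 0 * v 1 - w 1 * v 0 with hα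
  set β := u 0 * w 1 - u 1 * w 0 with hβ
  set X : (Fin 2 → ZMod 7) → ZMod 7 := fun e => (e 0 * v 1 - e 1 * v 0) / α with hX
  set Y : (Fin 2 → ZMod 7) → ZMod 7 := fun e => (u 0 * e 1 - u 1 * e 0) / β with hY
  set a : Fin 2 → ZMod 7 := (α / δ) • u with ha
  set b : Fin 2 → ZMod 7 := (β / δ) • v with hb
  have hab : a + b = w := by
    ext i
    fin_cases i <;> simp [ha, hb] <;> field_simp <;> simp only [hα, hβ, hδ] <;> ring
  have hdec : ∀ e, e = X e • a + Y e • b := by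
    intro e
    ext i
    fin_cases i <;> simp [ha, hb, hX, hY] <;> field_simp <;> simp only [hδ] <;> ring
  have iX : ∀ e ∈ E, ∀ e' ∈ E, X e = X e' → e = e' := by
    intro e he e' he' h
    refine k2 e he e' he' ((Y e - Y e') * (β / δ)) ?_
    rw [mul_smul, ← hb]
    conv_lhs => rw [hdec e, hdec e', h]
    module
  have iY : ∀ e ∈ E, ∀ e' ∈ E, Y e = Y e' → e = e' := by
    intro e he e' he' h
    refine k1 e he e' he' ((X e - X e') * (α / δ)) ?_
    rw [mul_smul, ← ha]
    conv_lhs => rw [hdec e, hdec e', h]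
    module
  have iZ : ∀ e ∈ E, ∀ e' ∈ E, Y e - X e = Y e' - X e' → e = e' := by
    intro e he e' he' h
    refine k3 e he e' he' (X e - X e') ?_
    have hy : Y e = Y e' + (X e - X e') := by linear_combination h
    rw [← hab]
    conv_lhs => rw [hdec e, hdec e', hy]
    module
  have himg : E.image X = univ := by
    apply Finset.eq_univ_of_card
    rw [Finset.card_image_of_injOn (fun e he e' he' h => iX e he e' he' h), hcard, ZMod.card]
  have hsurj : ∀ t : ZMod 7, ∃ e ∈ E, X e = t := by
    intro t
    have : t ∈ E.image X := by rw [himg]; exact mem_univ t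
    simpa using this
  choose g hgE hgX using hsurj
  have hginj : Function.Injective g := fun s t h => by rw [← hgX s, ← hgX t, h]
  obtain ⟨m, c, hmc⟩ := orth_collinear (fun t => Y (g t))
    (fun s t h => hginj (iY _ (hgE s) _ (hgE t) h))
    (fun s t h => hginj (iZ _ (hgE s) _ (hgE t) (by rw [hgX, hgX]; exact h)))
  have hne : a + m • b ≠ 0 := by
    intro h
    have h0 := congrFun h 0
    have h1 := congrFun h 1
    simp [ha, hb] at h0 h1
    have hα0 : α / δ * δ = 0 := by
      rw [hδ]
      linear_combination v 1 * h0 - v 0 * h1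
    rw [div_mul_cancel₀ _ d12] at hα0
    exact d32 hα0
  have hle := hcol (c • b) (Submodule.span (ZMod 7) {a + m • b}) (finrank_span_singleton hne)
  have hsub : (((((univ : Finset (ZMod 7)).filter (fun t => Y (g t) = m * t + c)).image g :
      Finset (Fin 2 → ZMod 7)) : Set (Fin 2 → ZMod 7))) ⊆
      (E : Set (Fin 2 → ZMod 7)) ∩
        {y | y - c • b ∈ Submodule.span (ZMod 7) {a + m • b}} := by
    intro e he
    simp only [coe_image, coe_filter, mem_univ, true_and, Set.mem_image, Set.mem_ofPred_eq] at he
    obtain ⟨t, ht, rfl⟩ := he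
    refine ⟨hgE t, Submodule.mem_span_singleton.2 ⟨t, ?_⟩⟩
    conv_rhs => rw [hdec (g t), hgX, ht]
    module
  have h4 := Set.ncard_le_ncard hsub (Set.toFinite _)
  rw [Set.ncard_coe_finset, Finset.card_image_of_injective _ hginj] at h4
  omega
end
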